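/- arXiv:math/0510104 — 7 statements merged into one kernel-verified Lean document; each statement's English description precedes it below -/
import Mathlib

section
/- Let R be a commutative semilocal ring and let M be a finitely generated R-module. Then the endomorphism ring End_R(M) is semilocal. -/
/-- A ring is semilocal if its quotient by the Jacobson radical is a semisimple
(artinian) ring. -/
def IsSemilocalRing (R : Type*) [Ring R] : Prop :=
  IsSemisimpleRing (TwoSidedIdeal.jacobson (⊥ : TwoSidedIdeal R)).ringCon.Quotient

theorem isSemilocalRing_iff_quotient (A : Type*) [Ring A] :
    IsSemilocalRing A ↔ IsSemisimpleRing (A ⧸ Ring.jacobson A) := by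
  have key : ∀ x : A, x ∈ Ring.jacobson A ↔
      (TwoSidedIdeal.jacobson (⊥ : TwoSidedIdeal A)).ringCon x 0 := by
    intro x
    rw [← TwoSidedIdeal.mem_iff, TwoSidedIdeal.mem_jacobson_iff, ← Ideal.jacobson_bot,
      Ideal.mem_jacobson_iff]
    simp [TwoSidedIdeal.mem_bot]
  unfold IsSemilocalRing
  constructor
  · intro h
    refine RingHom.isSemisimpleRing_of_surjective
      (RingCon.lift (TwoSidedIdeal.jacobson (⊥ : TwoSidedIdeal A)).ringCon (Ideal.Quotient.mk (Ring.jacobson A)) ?_) ?_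
    · intro x y hxy
      rw [RingCon.ker_apply, Ideal.Quotient.eq, key]
      rw [TwoSidedIdeal.rel_iff] at hxy
      rwa [← TwoSidedIdeal.mem_iff]
    · intro x
      obtain ⟨a, rfl⟩ := Ideal.Quotient.mk_surjective x
      exact ⟨(a : RingCon.Quotient _), rfl⟩
  · intro h
    refine RingHom.isSemisimpleRing_of_surjective
      (Ideal.Quotient.lift (Ring.jacobson A) (RingCon.mk' _) ?_) ?_
    · intro x hx
      exact (RingCon.eq _).2 ((key x).1 hx)
    · intro x
      obtain ⟨a, rfl⟩ := RingCon.mk'_surjective _ x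
      exact ⟨Ideal.Quotient.mk _ a, rfl⟩

/-- An endomorphism of a f.g. module with image in `J(R) M` is in the radical. -/
theorem mem_jacobson_end {R M : Type*} [CommRing R] [AddCommGroup M] [Module R M]
    [Module.Finite R M] (f : Module.End R M)
    (hf : ∀ m, f m ∈ Ring.jacobson R • (⊤ : Submodule R M)) :
    f ∈ Ring.jacobson (Module.End R M) := by
  rw [← Ideal.jacobson_bot, Ideal.mem_jacobson_iff]
  intro g
  have hgf : ∀ m, g (f m) ∈ Ring.jacobson R • (⊤ : Submodule R M) := fun m ↦ by
    have h1 : g (f m) ∈ (Ring.jacobson R • (⊤ : Submodule R M)).map g :=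
      Submodule.mem_map_of_mem (hf m)
    rw [Submodule.map_smul''] at h1
    exact Submodule.smul_mono le_rfl le_top h1
  have hs : Function.Surjective (g * f + 1 : Module.End R M) := by
    rw [← LinearMap.range_eq_top, ← top_le_iff]
    apply Submodule.le_of_le_smul_of_le_jacobson_bot (I := Ring.jacobson R)
      (Module.Finite.fg_top) (Ideal.jacobson_bot (R := R)).ge
    intro m _
    have : m = (g * f + 1 : Module.End R M) m - g (f m) := by simp
    rw [this]
    exact Submodule.sub_mem _ (Submodule.mem_sup_left ⟨m, rfl⟩) (Submodule.mem_sup_right (hgf m))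
  have hb := OrzechProperty.bijective_of_surjective_endomorphism _ hs
  obtain ⟨u, hu⟩ := (Module.End.isUnit_iff _).2 hb
  refine ⟨↑u⁻¹, ?_⟩
  have : (↑u⁻¹ : Module.End R M) * (g * f + 1) = 1 := by rw [← hu]; simp
  rw [Ideal.mem_bot, sub_eq_zero, mul_assoc, ← this, mul_add, mul_one]

/-- Every finitely generated module over a commutative semilocal ring has a
semilocal endomorphism ring. -/
theorem isSemilocalRing_end_of_finite {R M : Type*} [CommRing R] [AddCommGroup M] [Module R M]
    (hR : IsSemilocalRing R) [Module.Finite R M] :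
    IsSemilocalRing (Module.End R M) := by
  rw [isSemilocalRing_iff_quotient] at hR ⊢
  set J := Ring.jacobson R with hJ
  have hA : IsArtinian R (R ⧸ J) :=
    isArtinian_of_surjective_algebraMap (M := R ⧸ J) (R := R ⧸ J)
      (Ideal.Quotient.mk_surjective (I := J))
  obtain ⟨n, s, hs⟩ := Module.Finite.exists_fin (R := R) (M := M)
  let N := M ⧸ (J • (⊤ : Submodule R M))
  have : Module.Finite (R ⧸ J) N := Module.Finite.of_restrictScalars_finite R _ _
  have hN' : IsArtinian (R ⧸ J) N := inferInstance
  have hN : IsArtinian R N :=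
    isArtinian_of_surjective_algebraMap (M := N) (R := R ⧸ J)
      (Ideal.Quotient.mk_surjective (I := J))
  let Φ : Module.End R M →ₗ[R] (Fin n → N) :=
    LinearMap.pi fun i ↦ (Submodule.mkQ (J • (⊤ : Submodule R M))) ∘ₗ LinearMap.applyₗ (s i)
  have hker : ∀ f, Φ f = 0 → f ∈ Ring.jacobson (Module.End R M) := by
    intro f hf
    apply mem_jacobson_end
    have h2 : Submodule.span R (Set.range s) ≤ (J • (⊤ : Submodule R M)).comap f := by
      rw [Submodule.span_le]
      rintro _ ⟨i, rfl⟩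
      have := congrFun hf i
      exact (Submodule.Quotient.mk_eq_zero (J • (⊤ : Submodule R M))).1 this
    rw [hs] at h2
    exact fun m ↦ h2 trivial
  have hr : IsArtinian R (Module.End R M ⧸ LinearMap.ker Φ) :=
    isArtinian_of_injective _ (LinearMap.ker_eq_bot.1 (Submodule.ker_liftQ_eq_bot' _ Φ rfl))
  have hle : LinearMap.ker Φ ≤ (Ring.jacobson (Module.End R M)).restrictScalars R :=
    fun f hf ↦ hker f hf
  have hQ0 : IsArtinian R (Module.End R M ⧸ (Ring.jacobson (Module.End R M)).restrictScalars R) :=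
    isArtinian_of_surjective _ (Submodule.factor hle) (Submodule.factor_surjective hle)
  have hQ : IsArtinian R (Module.End R M ⧸ Ring.jacobson (Module.End R M)) :=
    isArtinian_of_surjective _ (Submodule.Quotient.restrictScalarsEquiv R
      (Ring.jacobson (Module.End R M))).toLinearMap (LinearEquiv.surjective _)
  have hQr : IsArtinianRing (Module.End R M ⧸ Ring.jacobson (Module.End R M)) :=
    isArtinian_of_tower R hQ
  rw [IsArtinianRing.isSemisimpleRing_iff_jacobson]
  exact Ring.jacobson_quotient_jacobson _
end

section
/- Let R be a semilocal ring and let M be a finitely presented R-module. Then the endomorphism ring End_R(M) is semilocal. -/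
theorem semisimple_of_ker_le {R A B : Type*} [Ring R] [Ring A] [Ring B] (p : R →+* A)
    (q : R →+* B) (hp : Function.Surjective p) (hq : Function.Surjective q)
    (h : ∀ x, p x = 0 → q x = 0) [IsSemisimpleRing A] : IsSemisimpleRing B := by
  let l : A →+* B := p.liftOfSurjective hp ⟨q, fun x hx => h x hx⟩
  have hl : Function.Surjective l := by
    intro b
    obtain ⟨r, rfl⟩ := hq b
    exact ⟨p r, RingHom.liftOfRightInverse_comp_apply p _ _ ⟨q, fun x hx => h x hx⟩ r⟩
  exact l.isSemisimpleRing_of_surjective hl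

theorem mk_eq_zero_iff_mem {R : Type*} [Ring R] (x : R) :
    (TwoSidedIdeal.jacobson (⊥ : TwoSidedIdeal R)).ringCon.mk' x = 0 ↔ x ∈ Ring.jacobson R := by
  rw [← TwoSidedIdeal.mem_ker, TwoSidedIdeal.ker_ringCon_mk', ← TwoSidedIdeal.mem_asIdeal,
    TwoSidedIdeal.asIdeal_jacobson, ← Ideal.jacobson_bot]
  simp

theorem isSemilocalRing_iff {R : Type*} [Ring R] :
    IsSemilocalRing R ↔ IsSemisimpleRing (R ⧸ Ring.jacobson R) := by
  constructor
  · intro h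
    have : IsSemisimpleRing (TwoSidedIdeal.jacobson (⊥ : TwoSidedIdeal R)).ringCon.Quotient := h
    refine semisimple_of_ker_le (TwoSidedIdeal.jacobson (⊥ : TwoSidedIdeal R)).ringCon.mk'
      (Ideal.Quotient.mk (Ring.jacobson R)) (RingCon.mk'_surjective _)
      Ideal.Quotient.mk_surjective fun x hx => ?_
    rw [Ideal.Quotient.eq_zero_iff_mem]
    exact (mk_eq_zero_iff_mem x).1 hx
  · intro h
    refine semisimple_of_ker_le (Ideal.Quotient.mk (Ring.jacobson R))
      (TwoSidedIdeal.jacobson (⊥ : TwoSidedIdeal R)).ringCon.mk'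
      Ideal.Quotient.mk_surjective (RingCon.mk'_surjective _) fun x hx => ?_
    rw [Ideal.Quotient.eq_zero_iff_mem] at hx
    exact (mk_eq_zero_iff_mem x).2 hx

theorem isSemilocalRing_of_surjective {S T : Type*} [Ring S] [Ring T] (f : S →+* T)
    (hf : Function.Surjective f) (h : IsSemilocalRing S) : IsSemilocalRing T := by
  rw [isSemilocalRing_iff] at h ⊢
  refine semisimple_of_ker_le (Ideal.Quotient.mk (Ring.jacobson S))
    ((Ideal.Quotient.mk (Ring.jacobson T)).comp f) Ideal.Quotient.mk_surjective
    (Ideal.Quotient.mk_surjective.comp hf) fun x hx => ?_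
  rw [Ideal.Quotient.eq_zero_iff_mem] at hx
  rw [RingHom.comp_apply, Ideal.Quotient.eq_zero_iff_mem]
  have : RingHomSurjective f := ⟨hf⟩
  exact Ring.le_comap_jacobson f hx

/-- length of the kernels: the Camps-Dicks identity -/
theorem length_ker_sub {A X : Type*} [Ring A] [AddCommGroup X] [Module A X]
    (a b : Module.End A X) :
    Module.length A (LinearMap.ker (a - a * b * a)) =
      Module.length A (LinearMap.ker a) + Module.length A (LinearMap.ker (1 - b * a)) := by
  have h1 : LinearMap.ker a ≤ LinearMap.ker (a - a * b * a) := by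
    intro x hx
    rw [LinearMap.mem_ker] at hx ⊢
    simp [hx]
  have h2 : ∀ x : LinearMap.ker (a - a * b * a),
      (b * a) (x : X) ∈ LinearMap.ker (1 - b * a) := by
    rintro ⟨x, hx⟩
    rw [LinearMap.mem_ker] at hx ⊢
    simp only [LinearMap.sub_apply, Module.End.mul_apply, Module.End.one_apply] at hx ⊢
    rw [← map_sub, hx, map_zero]
  let g : LinearMap.ker (a - a * b * a) →ₗ[A] LinearMap.ker (1 - b * a) :=
    LinearMap.codRestrict _ ((b * a) ∘ₗ (LinearMap.ker (a - a * b * a)).subtype) h2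
  refine Module.length_eq_add_of_exact (Submodule.inclusion h1) g
    (Submodule.inclusion_injective h1) ?_ ?_
  · rintro ⟨y, hy⟩
    have hy' := hy
    rw [LinearMap.mem_ker] at hy'
    simp only [LinearMap.sub_apply, Module.End.mul_apply, Module.End.one_apply,
      sub_eq_zero] at hy'
    refine ⟨⟨y, ?_⟩, ?_⟩
    · rw [LinearMap.mem_ker]
      simp only [LinearMap.sub_apply, Module.End.mul_apply]
      rw [← hy', sub_self]
    · apply Subtype.ext
      exact hy'.symm
  · rintro ⟨x, hx⟩
    constructor
    · intro h
      have h' : b (a x) = 0 := congrArg Subtype.val h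
      rw [LinearMap.mem_ker] at hx
      simp only [LinearMap.sub_apply, Module.End.mul_apply, h', map_zero, sub_zero] at hx
      exact ⟨⟨x, hx⟩, rfl⟩
    · rintro ⟨⟨z, hz⟩, h⟩
      have h' : z = x := congrArg Subtype.val h
      subst h'
      apply Subtype.ext
      change b (a z) = 0
      rw [LinearMap.mem_ker.1 hz, map_zero]

/-- A ring acting on a module of finite length so that elements acting
injectively are units is semilocal (Camps-Dicks). -/
theorem isSemilocalRing_of_local {S A X : Type*} [Ring S] [Ring A] [AddCommGroup X] [Module A X]
    [IsArtinian A X] [IsNoetherian A X] (φ : S →+* Module.End A X)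
    (hφ : ∀ s, Function.Injective (φ s) → IsUnit s) : IsSemilocalRing S := by
  rw [isSemilocalRing_iff]
  let d : S → ℕ := fun s => (Module.length A (LinearMap.ker (φ s))).toNat
  have hd : ∀ s, (d s : ℕ∞) = Module.length A (LinearMap.ker (φ s)) := fun s =>
    ENat.coe_toNat Module.length_ne_top
  have hadd : ∀ a b, d (a - a * b * a) = d a + d (1 - b * a) := by
    intro a b
    have := length_ker_sub (φ a) (φ b)
    rw [← map_mul, ← map_mul, ← map_mul, ← map_sub, ← map_one φ, ← map_sub, ← hd, ← hd,
      ← hd] at this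
    exact_mod_cast this
  have hunit : ∀ a, d a = 0 → IsUnit a := by
    intro a ha
    apply hφ
    have := hd a
    rw [ha, Nat.cast_zero, eq_comm, Module.length_eq_zero_iff] at this
    rw [← LinearMap.ker_eq_bot]
    exact (Submodule.subsingleton_iff_eq_bot).1 this
  have hbd : ∀ a, d a ≤ (Module.length A X).toNat := by
    intro a
    have : (d a : ℕ∞) ≤ Module.length A X := by
      rw [hd]
      exact Module.length_le_of_injective (LinearMap.ker (φ a)).subtype
        (Submodule.subtype_injective _)
    exact ENat.toNat_le_toNat (hd a ▸ this) Module.length_ne_top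
  have key : ∀ I : Ideal S, ∃ I' : Ideal S, I ⊔ I' = ⊤ ∧ I ⊓ I' ≤ Ring.jacobson S := by
    intro I
    let D : Set ℕ := {n | ∃ a : S, 1 - a ∈ I ∧ d a = n}
    have hne : D.Nonempty := ⟨d 1, 1, by simp, rfl⟩
    have hbdd : BddAbove D := ⟨_, by rintro _ ⟨a, -, rfl⟩; exact hbd a⟩
    obtain ⟨a, haI, hda⟩ := Nat.sSup_mem hne hbdd
    have hmax : ∀ c, 1 - c ∈ I → d c ≤ d a := fun c hc => hda ▸ le_csSup hbdd ⟨c, hc, rfl⟩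
    refine ⟨Ideal.span {a}, ?_, ?_⟩
    · rw [Ideal.eq_top_iff_one]
      have : (1 : S) = (1 - a) + a := by abel
      rw [this]
      exact Submodule.add_mem_sup haI (Ideal.mem_span_singleton_self a)
    · rintro x ⟨hxI, hxa⟩
      obtain ⟨c, rfl⟩ := Ideal.mem_span_singleton'.1 hxa
      rw [← Ideal.jacobson_bot, Ideal.mem_jacobson_iff]
      intro y
      have h1 : d (a - a * (-y * c) * a) = d a + d (1 - (-y * c) * a) := hadd _ _
      have h2 : d (a - a * (-y * c) * a) ≤ d a := by
        apply hmax
        have : 1 - (a - a * (-y * c) * a) = (1 - a) + (-(a * y)) * (c * a) := by noncomm_ring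
        rw [this]
        exact I.add_mem haI (I.mul_mem_left _ hxI)
      obtain ⟨u, hu⟩ := hunit (1 - (-y * c) * a) (by omega)
      refine ⟨(↑u⁻¹ : S), ?_⟩
      have : (↑u⁻¹ : S) * y * (c * a) + ↑u⁻¹ - 1 = ↑u⁻¹ * (1 - (-y * c) * a) - 1 := by
        noncomm_ring
      rw [this, ← hu]
      simp
  have hc : ComplementedLattice (Ideal (S ⧸ Ring.jacobson S)) := by
    refine ⟨fun L => ?_⟩
    let q := Ideal.Quotient.mk (Ring.jacobson S)
    have hq : Function.Surjective q := Ideal.Quotient.mk_surjective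
    obtain ⟨I', h1, h2⟩ := key (L.comap q)
    refine ⟨I'.map q, ?_⟩
    constructor
    · rw [disjoint_iff, eq_bot_iff]
      rintro x ⟨hxL, hx⟩
      obtain ⟨y, hy, rfl⟩ := (Ideal.mem_map_iff_of_surjective q hq).1 hx
      rw [Ideal.mem_bot, Ideal.Quotient.eq_zero_iff_mem]
      exact h2 ⟨hxL, hy⟩
    · rw [codisjoint_iff, ← Ideal.map_comap_of_surjective q hq L, ← Ideal.map_sup, h1,
        Ideal.map_top]
  exact (isSemisimpleModule_iff _ _).2 hc

section
variable {R : Type*} [Ring R] (P : Type*) [AddCommGroup P] [Module R P]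

/-- The reduction of a module modulo the Jacobson radical of the ring. -/
abbrev Red (R : Type*) [Ring R] (P : Type*) [AddCommGroup P] [Module R P] : Type _ :=
  P ⧸ (Ring.jacobson R • (⊤ : Submodule R P))

theorem red_le (h : Module.End R P) : (Ring.jacobson R • (⊤ : Submodule R P)) ≤
    (Ring.jacobson R • (⊤ : Submodule R P)).comap h := by
  rw [Submodule.smul_le]
  intro r hr x _
  rw [Submodule.mem_comap, map_smul]
  exact Submodule.smul_mem_smul hr trivial

/-- Reduction of endomorphisms. -/
def redHom : Module.End R P →+* Module.End R (Red R P) where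
  toFun h := Submodule.mapQ _ _ h (red_le P h)
  map_one' := by ext; rfl
  map_mul' _ _ := by ext; rfl
  map_zero' := by ext; rfl
  map_add' _ _ := by ext; rfl

theorem red_finite (hR : IsSemilocalRing R) [Module.Finite R P] :
    IsArtinian R (Red R P) ∧ IsNoetherian R (Red R P) := by
  rw [isSemilocalRing_iff] at hR
  have ht : Module.IsTorsionBySet R (Red R P) (Ring.jacobson R) := by
    rintro x ⟨r, hr⟩
    obtain ⟨x, rfl⟩ := Submodule.mkQ_surjective _ x
    change r • Submodule.mkQ _ x = 0
    rw [← map_smul]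
    exact (Submodule.Quotient.mk_eq_zero _).2 (Submodule.smul_mem_smul hr trivial)
  letI := ht.module
  have hs : IsSemisimpleModule R (Red R P) := ht.isSemisimpleModule_iff.1 inferInstance
  have hf : Module.Finite R (Red R P) := inferInstance
  exact ⟨(IsSemisimpleModule.finite_tfae.out 0 2).1 hf, (IsSemisimpleModule.finite_tfae.out 0 1).1 hf⟩

theorem surj_of_red [Module.Finite R P] (h : Module.End R P)
    (hh : Function.Surjective (redHom P h)) : Function.Surjective h := by
  rw [← LinearMap.range_eq_top]
  by_contra hne
  obtain ⟨C, hC, hle⟩ := (eq_top_or_exists_le_coatom (LinearMap.range h)).resolve_left hne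
  apply hC.1
  rw [eq_top_iff]
  rintro x -
  have hJ : (Ring.jacobson R • (⊤ : Submodule R P)) ≤ C :=
    (Ring.jacobson_smul_top_le R P).trans (sInf_le hC)
  obtain ⟨y, hy⟩ := hh (Submodule.mkQ _ x)
  obtain ⟨y, rfl⟩ := Submodule.mkQ_surjective _ y
  have hy' : h y - x ∈ (Ring.jacobson R • (⊤ : Submodule R P)) :=
    (Submodule.Quotient.eq _).1 hy
  have := C.sub_mem (hle ⟨y, rfl⟩) (hJ hy')
  simpa using this

theorem isUnit_of_red (hR : IsSemilocalRing R) [Module.Finite R P] [Module.Projective R P]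
    (h : Module.End R P) (hh : Function.Injective (redHom P h)) : IsUnit h := by
  obtain ⟨_, _⟩ := red_finite P hR
  have hs : Function.Surjective h :=
    surj_of_red P h (IsArtinian.surjective_of_injective_endomorphism _ hh)
  obtain ⟨s, hs⟩ := Module.projective_lifting_property h LinearMap.id hs
  have hs1 : h * s = 1 := hs
  have hr : redHom P h * redHom P s = 1 := by rw [← map_mul, hs1, map_one]
  have hs2 : Function.Surjective s := by
    apply surj_of_red
    intro x
    exact ⟨redHom P h x, hh (by
      change (redHom P h * redHom P s) _ = _
      rw [hr]; rfl)⟩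
  have hs3 : s * h = 1 := by
    ext x
    obtain ⟨y, rfl⟩ := hs2 x
    change s ((h * s) y) = s y
    rw [hs1]; rfl
  exact ⟨⟨h, s, hs1, hs3⟩, rfl⟩

end

/-- Endomorphisms of a two-term complex `ι : N → F`. -/
def pairRing {R N F : Type*} [Ring R] [AddCommGroup N] [Module R N] [AddCommGroup F] [Module R F]
    (ι : N →ₗ[R] F) : Subring (Module.End R F × Module.End R N) where
  carrier := {p | ∀ x, p.1 (ι x) = ι (p.2 x)}
  one_mem' _ := rfl
  zero_mem' _ := by simp
  mul_mem' {a b} ha hb x := by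
    change a.1 (b.1 (ι x)) = ι (a.2 (b.2 x))
    rw [hb, ha]
  add_mem' {a b} ha hb x := by
    change a.1 (ι x) + b.1 (ι x) = ι (a.2 x + b.2 x)
    rw [hb, ha, map_add]
  neg_mem' {a} ha x := by
    change -(a.1 (ι x)) = ι (-(a.2 x))
    rw [ha, map_neg]

theorem isSemilocalRing_pairRing {R N F : Type*} [Ring R] [AddCommGroup N] [Module R N]
    [AddCommGroup F] [Module R F] (hR : IsSemilocalRing R) [Module.Finite R N]
    [Module.Projective R N] [Module.Finite R F] [Module.Projective R F] (ι : N →ₗ[R] F) :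
    IsSemilocalRing (pairRing ι) := by
  obtain ⟨_, _⟩ := red_finite N hR
  obtain ⟨_, _⟩ := red_finite F hR
  let φ : pairRing ι →+* Module.End R (Red R F × Red R N) :=
    ((LinearMap.prodMapRingHom R (Red R F) (Red R N)).comp
      ((redHom F).prodMap (redHom N))).comp (pairRing ι).subtype
  refine isSemilocalRing_of_local φ ?_
  rintro ⟨⟨g, h⟩, hgh⟩ hinj
  have hinj' : Function.Injective (Prod.map (redHom F g) (redHom N h)) := hinj
  rw [Prod.map_injective] at hinj'
  obtain ⟨u, rfl⟩ := isUnit_of_red F hR g hinj'.1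
  obtain ⟨v, rfl⟩ := isUnit_of_red N hR h hinj'.2
  have hinv : ((↑u⁻¹, ↑v⁻¹) : Module.End R F × Module.End R N) ∈ pairRing ι := by
    intro x
    have hv : (v : Module.End R N) ((↑v⁻¹ : Module.End R N) x) = x :=
      LinearMap.congr_fun v.mul_inv x
    have hu : ∀ y, (↑u⁻¹ : Module.End R F) ((u : Module.End R F) y) = y :=
      fun y => LinearMap.congr_fun u.inv_mul y
    have := hgh ((↑v⁻¹ : Module.End R N) x)
    simp only [hv] at this
    change (↑u⁻¹ : Module.End R F) (ι x) = ι ((↑v⁻¹ : Module.End R N) x)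
    rw [← this, hu]
  exact ⟨⟨⟨_, hgh⟩, ⟨_, hinv⟩, Subtype.ext (Prod.ext u.mul_inv v.mul_inv),
    Subtype.ext (Prod.ext u.inv_mul v.inv_mul)⟩, rfl⟩

/-- The endomorphism ring of a finitely presented module over a semilocal ring
is a semilocal ring. -/
theorem isSemilocalRing_end_of_finitePresentation {R M : Type*} [Ring R] [AddCommGroup M]
    [Module R M] (hR : IsSemilocalRing R) [Module.FinitePresentation R M] :
    IsSemilocalRing (Module.End R M) := by
  obtain ⟨n, m, π, ι, hπ, hex⟩ := Module.FinitePresentation.exists_fin' R M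
  have hex' : ∀ x, π (ι x) = 0 := fun x => (hex _).2 ⟨x, rfl⟩
  have hdesc : ∀ p : pairRing ι, ∃ f : Module.End R M, ∀ x, f (π x) = π (p.1.1 x) := by
    rintro ⟨⟨g, h⟩, hgh⟩
    have hle : LinearMap.ker π ≤ LinearMap.ker (π ∘ₗ g) := by
      intro x hx
      obtain ⟨y, rfl⟩ := (hex x).1 hx
      change π (g (ι y)) = 0
      rw [show g (ι y) = ι (h y) from hgh y, hex']
    refine ⟨(LinearMap.ker π).liftQ (π ∘ₗ g) hle ∘ₗ
      (π.quotKerEquivOfSurjective hπ).symm.toLinearMap, fun x => ?_⟩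
    have : (π.quotKerEquivOfSurjective hπ).symm (π x) = (LinearMap.ker π).mkQ x := by
      rw [LinearEquiv.symm_apply_eq]
      rfl
    change (LinearMap.ker π).liftQ (π ∘ₗ g) hle
      ((π.quotKerEquivOfSurjective hπ).symm (π x)) = _
    rw [this]
    rfl
  choose ψ hψ using hdesc
  have hext : ∀ f f' : Module.End R M, (∀ x, f (π x) = f' (π x)) → f = f' := by
    intro f f' h
    ext y
    obtain ⟨x, rfl⟩ := hπ y
    exact h x
  let Ψ : pairRing ι →+* Module.End R M :=
    { toFun := ψ
      map_one' := hext _ _ fun x => by rw [hψ]; rfl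
      map_zero' := hext _ _ fun x => by rw [hψ]; exact map_zero π
      map_mul' := fun a b => hext _ _ fun x => by
        rw [hψ, Module.End.mul_apply, hψ, hψ]; rfl
      map_add' := fun a b => hext _ _ fun x => by
        rw [hψ, LinearMap.add_apply, hψ, hψ, ← map_add]; rfl }
  refine isSemilocalRing_of_surjective Ψ ?_ (isSemilocalRing_pairRing hR ι)
  intro f
  obtain ⟨g, hg⟩ := Module.projective_lifting_property π (f ∘ₗ π) hπ
  have hg' : ∀ x, π (g x) = f (π x) := fun x => LinearMap.congr_fun hg x
  have hmem : ∀ x, (g ∘ₗ ι) x ∈ LinearMap.range ι := by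
    intro x
    refine (hex _).1 ?_
    rw [LinearMap.comp_apply, hg', hex', map_zero]
  obtain ⟨h, hh⟩ := Module.projective_lifting_property ι.rangeRestrict
    ((g ∘ₗ ι).codRestrict (LinearMap.range ι) hmem) ι.surjective_rangeRestrict
  have hgh : ((g, h) : Module.End R _ × Module.End R _) ∈ pairRing ι := fun x =>
    (congrArg Subtype.val (LinearMap.congr_fun hh x)).symm
  exact ⟨⟨_, hgh⟩, hext _ _ fun x => (hψ ⟨_, hgh⟩ x).trans (hg' x)⟩
end

section
/- Let R be an arbitrary ring and let M be an artinian R-module. Then the endomorphism ring End_R(M) is semilocal. -/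
theorem exists_socle_aux (R M : Type*) [Ring R] [AddCommGroup M] [Module R M]
    [IsArtinian R M] : ∃ N : Submodule R M, IsNoetherian R N ∧
      ∀ K : Submodule R M, K ⊓ N = ⊥ → K = ⊥ := by
  refine ⟨⨆ m ∈ {m : Submodule R M | IsSimpleModule R m}, m, ?_, ?_⟩
  · have h : IsSemisimpleModule R ↥(⨆ m ∈ {m : Submodule R M | IsSimpleModule R m}, m) := by
      apply isSemisimpleModule_biSup_of_isSemisimpleModule_submodule
      intro i hi
      have : IsSimpleModule R i := hi
      infer_instance
    have ha : IsArtinian R ↥(⨆ m ∈ {m : Submodule R M | IsSimpleModule R m}, m) := inferInstance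
    have ht := IsSemisimpleModule.finite_tfae (R := R)
      (M := ↥(⨆ m ∈ {m : Submodule R M | IsSimpleModule R m}, m))
    exact (ht.out 2 1).mp ha
  · intro K hK
    rcases IsAtomic.eq_bot_or_exists_atom_le K with h | ⟨a, ha, haK⟩
    · exact h
    · have h1 : a ≤ ⨆ m ∈ {m : Submodule R M | IsSimpleModule R m}, m :=
        le_biSup (fun m => m) (isSimpleModule_iff_isAtom.mpr ha)
      exact absurd (le_bot_iff.mp (hK ▸ le_inf haK h1)) ha.1

/-- Every left ideal has a complement modulo quasi-regular elements. -/
theorem exists_compl_aux {R M : Type*} [Ring R] [AddCommGroup M] [Module R M]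
    [IsArtinian R M] (I : Ideal (Module.End R M)) :
    ∃ c : Module.End R M, 1 - c ∈ I ∧ ∀ a, a * c ∈ I → IsUnit (1 - a * c) := by
  obtain ⟨N, hN, hess⟩ := exists_socle_aux R M
  let F : Module.End R M → Submodule R N := fun c => (LinearMap.ker c).comap N.subtype
  obtain ⟨_, ⟨c, hc, rfl⟩, hmax⟩ := (wellFounded_gt (α := Submodule R N)).has_min
    (F '' {c | 1 - c ∈ I}) ⟨_, 1, by simp, rfl⟩
  refine ⟨c, hc, fun a ha => ?_⟩
  have hmem : 1 - (c - c * (a * c)) ∈ I := by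
    have : 1 - (c - c * (a * c)) = (1 - c) + c * (a * c) := by abel
    rw [this]
    exact I.add_mem hc (I.mul_mem_left c ha)
  have hle : F c ≤ F (c - c * (a * c)) := by
    intro x hx
    have hx' : c x = 0 := hx
    change (c - c * (a * c)) (x : M) = 0
    simp [hx']
  have heq : F c = F (c - c * (a * c)) := by
    by_contra hne
    exact hmax _ ⟨_, hmem, rfl⟩ (lt_of_le_of_ne hle hne)
  have hker : LinearMap.ker (1 - a * c) = ⊥ := by
    apply hess
    rw [eq_bot_iff]
    rintro x ⟨hx, hxN⟩
    have hx' : x - a (c x) = 0 := hx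
    have h2 : (⟨x, hxN⟩ : N) ∈ F (c - c * (a * c)) := by
      change c x - c (a (c x)) = 0
      rw [← map_sub, hx', map_zero]
    rw [← heq] at h2
    have h3 : c x = 0 := h2
    simpa [h3] using hx'
  rw [Module.End.isUnit_iff]
  exact IsArtinian.bijective_of_injective_endomorphism _ (LinearMap.ker_eq_bot.mp hker)

/-- The endomorphism ring of an artinian module over an arbitrary ring is
semilocal. -/
theorem isSemilocalRing_end_of_isArtinian {R M : Type*} [Ring R] [AddCommGroup M] [Module R M]
    [IsArtinian R M] : IsSemilocalRing (Module.End R M) := by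
  unfold IsSemilocalRing
  set J := TwoSidedIdeal.jacobson (⊥ : TwoSidedIdeal (Module.End R M)) with hJ
  let π : Module.End R M →+* J.ringCon.Quotient := J.ringCon.mk'
  have hsurj : Function.Surjective π := J.ringCon.mk'_surjective
  refine (isSemisimpleModule_iff _ _).mpr ⟨fun I => ?_⟩
  obtain ⟨c, hc, hu⟩ := exists_compl_aux (Ideal.comap π I)
  refine ⟨Ideal.span {π c}, ?_, ?_⟩
  · rw [Submodule.disjoint_def]
    intro y hy hyc
    obtain ⟨b, rfl⟩ := Ideal.mem_span_singleton'.mp hyc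
    obtain ⟨a, rfl⟩ := hsurj b
    rw [← map_mul] at hy ⊢
    have hac : a * c ∈ J := by
      rw [hJ, TwoSidedIdeal.mem_jacobson_iff]
      intro y
      have h1 : (-y * a) * c ∈ Ideal.comap π I := by
        rw [mul_assoc]
        exact Ideal.mul_mem_left _ _ hy
      obtain ⟨u, hu⟩ := hu _ h1
      refine ⟨↑u⁻¹, ?_⟩
      have h2 : (↑u⁻¹ : Module.End R M) * (1 - (-y * a) * c) = 1 := by
        rw [← hu]; exact u.inv_mul
      rw [TwoSidedIdeal.mem_bot, sub_eq_zero, ← h2]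
      noncomm_ring
    exact (RingCon.eq _).mpr hac
  · rw [codisjoint_iff, Ideal.eq_top_iff_one]
    have h1 : (1 : J.ringCon.Quotient) = π (1 - c) + π c := by simp
    rw [h1]
    exact Submodule.add_mem_sup hc (Ideal.mem_span_singleton_self _)
end

section
/- Let R be a ring and let M be an R-module of finite Goldie dimension such that every injective R-linear endomorphism of M is bijective. Then the endomorphism ring End_R(M) is semilocal. -/
/-- A module has finite Goldie (uniform) dimension if there is no infinite independent
family of nonzero submodules: every set of nonzero submodules, each of which meets the sum
of the others trivially, is finite. -/
def HasFiniteGoldieDimension (R M : Type*) [Ring R] [AddCommGroup M] [Module R M] : Prop :=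
  ∀ s : Set (Submodule R M), (∀ N ∈ s, N ≠ ⊥) →
    (∀ N ∈ s, N ⊓ sSup (s \ {N}) = ⊥) → s.Finite

/-- The Camps–Dicks relation on a ring. -/
def CDRel (S : Type*) [Ring S] (a' a : S) : Prop :=
  ∃ y, a' = a - a * y * a ∧ ¬ IsUnit (1 - y * a)

lemma CDRel.isSemisimpleRing {T : Type*} [Ring T] (wf : WellFounded (CDRel T))
    (hJ : ∀ t : T, t ≠ 0 → ∃ y, ¬ IsUnit (1 - y * t)) : IsSemisimpleRing T := by
  have key : ∀ t : T, t ≠ 0 → ∃ x : T, x * t ≠ 0 ∧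
      IsSimpleModule T (Submodule.span T {x * t}) := by
    intro t ht
    obtain ⟨a, ⟨⟨x, rfl⟩, ha0⟩, hmin⟩ :=
      wf.has_min {a | (∃ x, a = x * t) ∧ a ≠ 0} ⟨t, ⟨1, by simp⟩, ht⟩
    refine ⟨x, ha0, ?_⟩
    rw [isSimpleModule_iff_isAtom]
    refine ⟨by simpa [Submodule.span_singleton_eq_bot] using ha0, ?_⟩
    intro N hN
    by_contra hN0
    obtain ⟨b, hbN, hb0⟩ := N.ne_bot_iff.mp hN0
    obtain ⟨c, rfl⟩ := Submodule.mem_span_singleton.mp (hN.le hbN)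
    obtain ⟨y, hy⟩ := hJ _ hb0
    refine hN.not_ge ?_
    rw [Submodule.span_singleton_le_iff_mem]
    have h0 : x * t - x * t * (y * c) * (x * t) = 0 := by
      by_contra h
      refine hmin _ ⟨⟨x - x * t * (y * c) * x, by noncomm_ring⟩, h⟩ ⟨y * c, rfl, ?_⟩
      simpa [mul_assoc] using hy
    have h1 : x * t = (x * t * y) • (c • (x * t)) := by
      rw [sub_eq_zero] at h0
      simpa [mul_assoc] using h0
    rw [h1]
    exact N.smul_mem _ hbN
  refine IsSemisimpleModule.of_sSup_simples_eq_top ?_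
  by_contra hK
  set K := sSup {m : Submodule T T | IsSimpleModule T m} with hKdef
  have h1 : ∃ a, a ∉ K := by
    by_contra! h
    exact hK (eq_top_iff.mpr fun x _ => h x)
  obtain ⟨a, haK, hmin⟩ := wf.has_min {a | a ∉ K} h1
  have ha0 : a ≠ 0 := by rintro rfl; exact haK K.zero_mem
  obtain ⟨x, hx0, hx⟩ := key a ha0
  have hxK : x * a ∈ K := (le_sSup (a := Submodule.span T {x * a}) hx)
    (Submodule.mem_span_singleton_self _)
  obtain ⟨y, hy⟩ := hJ _ hx0
  refine hmin (a - a * (y * x) * a) ?_ ⟨y * x, rfl, by simpa [mul_assoc] using hy⟩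
  intro h
  apply haK
  have h2 : a * (y * x) * a ∈ K := by
    have := K.smul_mem (a * y) hxK
    simpa [mul_assoc] using this
  simpa using K.add_mem h h2

lemma CDRel.isSemilocalRing {S : Type*} [Ring S] (wf : WellFounded (CDRel S)) :
    IsSemilocalRing S := by
  unfold IsSemilocalRing
  set I := TwoSidedIdeal.jacobson (⊥ : TwoSidedIdeal S) with hI
  let p : S →+* I.ringCon.Quotient := I.ringCon.mk'
  have hp : Function.Surjective p := RingCon.mk'_surjective _
  have hker : ∀ x, p x = 0 ↔ x ∈ I := fun x => by
    rw [← TwoSidedIdeal.mem_ker, TwoSidedIdeal.ker_ringCon_mk']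
  refine CDRel.isSemisimpleRing ⟨fun t => ?_⟩ fun t ht => ?_
  · obtain ⟨a, rfl⟩ := hp t
    induction a using wf.induction with
    | _ a ih =>
      refine ⟨_, ?_⟩
      rintro _ ⟨y, rfl, hy⟩
      obtain ⟨y, rfl⟩ := hp y
      have := ih (a - a * y * a) ⟨y, rfl, fun h => hy (by simpa using h.map p)⟩
      simpa using this
  · obtain ⟨a, rfl⟩ := hp t
    rw [Ne, hker, TwoSidedIdeal.mem_jacobson_iff] at ht
    push Not at ht
    obtain ⟨y, hy⟩ := ht
    refine ⟨p (-y), fun h => ?_⟩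
    obtain ⟨w, hw⟩ := h.exists_left_inv
    obtain ⟨v, rfl⟩ := hp w
    have h1 : v * (1 + y * a) - 1 ∈ I := by
      rw [← hker]
      simp only [map_neg, neg_mul, sub_neg_eq_add] at hw
      simp [hw]
    rw [TwoSidedIdeal.mem_jacobson_iff] at h1
    obtain ⟨z, hz⟩ := h1 1
    apply hy (z * v)
    convert hz using 1
    noncomm_ring

lemma CDRel.wf_end {R M : Type*} [Ring R] [AddCommGroup M]
    [Module R M] (hdim : HasFiniteGoldieDimension R M)
    (hmono : ∀ f : M →ₗ[R] M, Function.Injective f → Function.Bijective f) :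
    WellFounded (CDRel (Module.End R M)) := by
  rw [wellFounded_iff_isEmpty_descending_chain]
  refine ⟨fun ⟨a, ha⟩ => ?_⟩
  choose y hy hu using ha
  let N : ℕ → Submodule R M := fun n => LinearMap.ker (1 - y n * a n)
  have hN0 : ∀ n, N n ≠ ⊥ := fun n h =>
    hu n ((Module.End.isUnit_iff _).mpr (hmono _ (LinearMap.ker_eq_bot.mp h)))
  have hdisj : ∀ n, Disjoint (N n) (LinearMap.ker (a n)) := by
    intro n
    rw [Submodule.disjoint_def]
    intro x hx hx'
    simp only [N, LinearMap.mem_ker] at hx hx'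
    simpa [hx'] using hx
  have hle : ∀ n, N n ⊔ LinearMap.ker (a n) ≤ LinearMap.ker (a (n + 1)) := by
    intro n
    refine sup_le ?_ ?_
    · intro x hx
      have : a (n + 1) = a n * (1 - y n * a n) := by rw [hy]; noncomm_ring
      simp only [N, LinearMap.mem_ker] at hx ⊢
      rw [this, Module.End.mul_apply, hx, map_zero]
    · intro x hx
      rw [LinearMap.mem_ker] at hx ⊢
      rw [hy]
      simp [hx]
  have hind : ∀ n, (Finset.range n).SupIndep N ∧
      (Finset.range n).sup N ≤ LinearMap.ker (a n) := by
    intro n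
    induction n with
    | zero => simp
    | succ n ih =>
      rw [Finset.range_add_one]
      refine ⟨ih.1.insert ((hdisj n).mono_right ih.2), ?_⟩
      rw [Finset.sup_insert]
      exact (sup_le_sup_left ih.2 _).trans (hle n)
  have hi : iSupIndep N := by
    rw [iSupIndep_iff_supIndep]
    intro s
    obtain ⟨n, hn⟩ := s.exists_nat_subset_range
    exact (hind n).1.subset hn
  have hfin := hdim (Set.range N) (by rintro _ ⟨n, rfl⟩; exact hN0 n)
    (fun P hP => (hi.sSupIndep_range hP).eq_bot)
  exact Set.infinite_range_of_injective (hi.injective hN0) hfin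

/-- Let `M` be a module of finite Goldie dimension such that every injective
endomorphism of `M` is bijective. Then `End_R(M)` is semilocal. -/
theorem isSemilocalRing_end_of_finiteGoldieDimension {R M : Type*} [Ring R] [AddCommGroup M]
    [Module R M] (hdim : HasFiniteGoldieDimension R M)
    (hmono : ∀ f : M →ₗ[R] M, Function.Injective f → Function.Bijective f) :
    IsSemilocalRing (Module.End R M) :=
  CDRel.isSemilocalRing (CDRel.wf_end hdim hmono)
end

section
/- Let R be a ring and let M be a finitely copresented R-module, i.e., suppose there is an exact sequence 0 → M → L₀ → L₁ → 0 of R-modules in which L₀ is an injective module and both L₀ and L₁ have finite Goldie dimension. Then the endomorphism ring End_R(M) is semilocal. -/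
/-- Chain condition extracted from finite Goldie dimension. -/
def GoldieChainCond (R X : Type*) [Ring R] [AddCommGroup X] [Module R X] : Prop :=
  ∀ K N : ℕ → Submodule R X, (∀ n, K n ≤ K (n + 1)) → (∀ n, N n ≤ K (n + 1)) →
    (∀ n, Disjoint (K n) (N n)) → {n | N n ≠ ⊥}.Finite

theorem HasFiniteGoldieDimension.chainCond {R X : Type*} [Ring R] [AddCommGroup X] [Module R X]
    (h : HasFiniteGoldieDimension R X) : GoldieChainCond R X := by
  classical
  intro K N hK hN hd
  have hmono : Monotone K := monotone_nat_of_le_succ hK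
  have hsup : ∀ n, (Finset.range n).sup N ≤ K n := by
    intro n
    refine Finset.sup_le fun m hm => (hN m).trans (hmono ?_)
    have := Finset.mem_range.1 hm
    omega
  have hr : ∀ n, (Finset.range n).SupIndep N := by
    intro n
    induction n with
    | zero => simp
    | succ n ih =>
      rw [Finset.range_add_one]
      exact ih.insert ((hd n).symm.mono_right (hsup n))
  have hind : iSupIndep N := by
    rw [iSupIndep_iff_supIndep]
    intro s
    obtain ⟨n, hn⟩ := s.exists_nat_subset_range
    exact (hr n).subset hn
  have hfin : (N '' {n | N n ≠ ⊥}).Finite := by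
    apply h
    · rintro _ ⟨n, hn, rfl⟩
      exact hn
    · intro A hA
      exact (((hind.sSupIndep_range).mono (Set.image_subset_range _ _)) hA).eq_bot
  exact hfin.of_finite_image hind.injOn

theorem GoldieChainCond.of_injective {R X Y : Type*} [Ring R] [AddCommGroup X] [Module R X]
    [AddCommGroup Y] [Module R Y] (h : GoldieChainCond R Y) (i : X →ₗ[R] Y)
    (hi : Function.Injective i) : GoldieChainCond R X := by
  intro K N hK hN hd
  have := h (fun n => (K n).map i) (fun n => (N n).map i) (fun n => Submodule.map_mono (hK n))
    (fun n => Submodule.map_mono (hN n)) (fun n => by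
      rw [Submodule.disjoint_def]
      rintro _ ⟨x, hx, rfl⟩ ⟨y, hy, hxy⟩
      obtain rfl := hi hxy
      rw [(Submodule.disjoint_def.1 (hd n)) _ hx hy, map_zero])
  refine this.subset fun n hn h0 => hn ?_
  rw [Submodule.eq_bot_iff]
  intro x hx
  apply hi
  have hx' : i x ∈ (N n).map i := ⟨x, hx, rfl⟩
  rw [map_zero]
  rw [h0] at hx'
  exact hx'

theorem GoldieChainCond.ring {R X T : Type*} [Ring R] [AddCommGroup X] [Module R X] [Ring T]
    (h : GoldieChainCond R X) (φ : T →+* Module.End R X) (c y : ℕ → T)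
    (hc : ∀ n, c (n + 1) = c n - c n * y n * c n) :
    {n | ¬ Function.Injective (φ (1 - y n * c n))}.Finite := by
  have := h (fun n => LinearMap.ker (φ (c n))) (fun n => LinearMap.ker (φ (1 - y n * c n)))
    (fun n x hx => by
      rw [LinearMap.mem_ker] at hx ⊢
      simp [hc, hx])
    (fun n x hx => by
      rw [LinearMap.mem_ker] at hx ⊢
      have e : c (n + 1) = c n * (1 - y n * c n) := by rw [hc]; noncomm_ring
      rw [e, map_mul, Module.End.mul_apply, hx, map_zero])
    (fun n => by
      rw [Submodule.disjoint_def]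
      intro x hx hx'
      rw [LinearMap.mem_ker] at hx hx'
      simpa [hx] using hx')
  refine this.subset fun n hn h0 => hn (LinearMap.ker_eq_bot.1 h0)

theorem exists_max_of_chainCond {R X Y T : Type*} [Ring R] [AddCommGroup X] [Module R X]
    [AddCommGroup Y] [Module R Y] [Ring T] (hX : GoldieChainCond R X) (hY : GoldieChainCond R Y)
    (φ : T →+* Module.End R X) (ψ : T →+* Module.End R Y) (I : Ideal T) :
    ∃ a ∈ I, ∀ y ∈ I, Function.Injective (φ (1 - y * (1 - a))) ∧
      Function.Injective (ψ (1 - y * (1 - a))) := by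
  by_contra! hcon
  have hstep : ∀ c : {c : T // 1 - c ∈ I}, ∃ y ∈ I, Function.Injective (φ (1 - y * c.1)) →
      ¬ Function.Injective (ψ (1 - y * c.1)) := by
    intro c
    have := hcon (1 - c.1) c.2
    simpa using this
  choose y hyI hy using hstep
  let next : {c : T // 1 - c ∈ I} → {c : T // 1 - c ∈ I} := fun c =>
    ⟨c.1 - c.1 * y c * c.1, by
      have e : 1 - (c.1 - c.1 * y c * c.1) =
          (1 - c.1) + (c.1 * y c - (c.1 * y c) * (1 - c.1)) := by noncomm_ring
      rw [e]
      exact I.add_mem c.2 (I.sub_mem (I.mul_mem_left _ (hyI c)) (I.mul_mem_left _ c.2))⟩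
  let s : ℕ → {c : T // 1 - c ∈ I} := fun n => next^[n] ⟨1, by simp⟩
  have hs : ∀ n, (s (n + 1)).1 = (s n).1 - (s n).1 * y (s n) * (s n).1 := by
    intro n
    simp only [s, Function.iterate_succ_apply']
    rfl
  have h1 := hX.ring φ (fun n => (s n).1) (fun n => y (s n)) hs
  have h2 := hY.ring ψ (fun n => (s n).1) (fun n => y (s n)) hs
  refine Set.infinite_univ (α := ℕ) ((h1.union h2).subset fun n _ => ?_)
  by_cases hn : Function.Injective (φ (1 - y (s n) * (s n).1))
  · exact Or.inr (hy _ hn)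
  · exact Or.inl hn

theorem isSemisimpleRing_of_right_unit {Q : Type*} [Ring Q]
    (h : ∀ I : Ideal Q, ∃ a ∈ I, ∀ y ∈ I, y = y * a) : IsSemisimpleRing Q := by
  rw [IsSemisimpleRing, isSemisimpleModule_iff]
  refine ⟨fun I => ?_⟩
  obtain ⟨a, ha, hI⟩ := h I
  refine ⟨LinearMap.ker (LinearMap.toSpanSingleton Q Q a), ?_, ?_⟩
  · rw [Submodule.disjoint_def]
    intro x hx hx'
    rw [LinearMap.mem_ker, LinearMap.toSpanSingleton_apply, smul_eq_mul] at hx'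
    rw [hI x hx, hx']
  · rw [codisjoint_iff, eq_top_iff]
    intro x _
    rw [Submodule.mem_sup]
    refine ⟨x * a, Ideal.mul_mem_left I _ ha, x - x * a, ?_, by simp⟩
    rw [LinearMap.mem_ker, LinearMap.toSpanSingleton_apply, smul_eq_mul, sub_mul, mul_assoc,
      ← hI a ha, sub_self]

theorem isSemilocalRing_of_chainCond {R X Y T S : Type*} [Ring R] [AddCommGroup X] [Module R X]
    [AddCommGroup Y] [Module R Y] [Ring T] [Ring S]
    (hX : GoldieChainCond R X) (hY : GoldieChainCond R Y)
    (φ : T →+* Module.End R X) (ψ : T →+* Module.End R Y) (π : T →+* S)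
    (hπ : Function.Surjective π)
    (hu : ∀ t, Function.Injective (φ t) → Function.Injective (ψ t) → IsUnit (π t)) :
    IsSemilocalRing S := by
  apply isSemisimpleRing_of_right_unit
  intro I
  let q : S →+* (TwoSidedIdeal.jacobson (⊥ : TwoSidedIdeal S)).ringCon.Quotient :=
    (TwoSidedIdeal.jacobson (⊥ : TwoSidedIdeal S)).ringCon.mk'
  have hq : Function.Surjective q := RingCon.mk'_surjective _
  obtain ⟨a, ha, hmax⟩ := exists_max_of_chainCond hX hY φ ψ (I.comap (q.comp π))
  refine ⟨q (π a), ha, fun z hz => ?_⟩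
  obtain ⟨z, rfl⟩ := hq z
  obtain ⟨z, rfl⟩ := hπ z
  have hmem : π (z * (1 - a)) ∈ TwoSidedIdeal.jacobson (⊥ : TwoSidedIdeal S) := by
    rw [TwoSidedIdeal.mem_jacobson_iff]
    intro w
    obtain ⟨w, rfl⟩ := hπ w
    have hwz : -(w * z) ∈ I.comap (q.comp π) := by
      apply neg_mem
      exact Ideal.mul_mem_left _ _ hz
    obtain ⟨u, hu'⟩ := hu _ (hmax _ hwz).1 (hmax _ hwz).2
    refine ⟨(u⁻¹ : Sˣ), ?_⟩
    have e : ((u⁻¹ : Sˣ) : S) * π w * π (z * (1 - a)) + ((u⁻¹ : Sˣ) : S) - 1 = 0 := by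
      have h3 : ((u⁻¹ : Sˣ) : S) * u = 1 := u.inv_mul
      rw [hu'] at h3
      rw [← h3]
      simp only [map_mul, map_sub, map_one, map_neg]
      noncomm_ring
    rw [e]
    exact zero_mem _
  have h0 : q (π (z * (1 - a))) = 0 := by
    rw [← TwoSidedIdeal.mem_ker, TwoSidedIdeal.ker_ringCon_mk']
    exact hmem
  rw [map_mul, map_mul, map_sub, map_sub, map_one, map_one, mul_sub, mul_one, sub_eq_zero] at h0
  exact h0

theorem surjective_of_chainCond {R L : Type*} [Ring R] [AddCommGroup L] [Module R L]
    (hL : GoldieChainCond R L) (hinj : Module.Injective R L) (f : Module.End R L)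
    (hf : Function.Injective f) : Function.Surjective f := by
  obtain ⟨g, hg⟩ := hinj.out f hf LinearMap.id
  have hgf : ∀ x, g (f x) = x := hg
  have hpow : ∀ n x, (g ^ n) ((f ^ n) x) = x := by
    intro n
    induction n with
    | zero => intro x; rfl
    | succ n ih =>
      intro x
      rw [pow_succ g, pow_succ' f, Module.End.mul_apply, Module.End.mul_apply, hgf, ih]
  have hfin := hL (fun n => LinearMap.ker (g ^ n)) (fun n => (LinearMap.ker g).map (f ^ n))
    (fun n x hx => by
      rw [LinearMap.mem_ker] at hx ⊢
      rw [pow_succ', Module.End.mul_apply, hx, map_zero])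
    (fun n => by
      rintro _ ⟨x, hx, rfl⟩
      rw [LinearMap.mem_ker, pow_succ', Module.End.mul_apply, hpow]
      exact hx)
    (fun n => by
      rw [Submodule.disjoint_def]
      rintro _ hx' ⟨x, hx, rfl⟩
      rw [LinearMap.mem_ker, hpow] at hx'
      rw [hx', map_zero])
  intro y
  have hy : y - f (g y) ∈ LinearMap.ker g := by
    rw [LinearMap.mem_ker, map_sub, hgf, sub_self]
  refine ⟨g y, ?_⟩
  by_contra hne
  refine Set.infinite_univ (α := ℕ) (hfin.subset fun n _ h0 => hne ?_)
  have h1 : (f ^ n) (y - f (g y)) = 0 := by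
    have : (f ^ n) (y - f (g y)) ∈ (LinearMap.ker g).map (f ^ n) := ⟨_, hy, rfl⟩
    rw [h0] at this
    exact this
  have h2 := hpow n (y - f (g y))
  rw [h1, map_zero] at h2
  exact (sub_eq_zero.1 h2.symm).symm

/-- Endomorphisms of the exact sequence. -/
def seqEnd {R M L₀ L₁ : Type*} [Ring R]
    [AddCommGroup M] [Module R M] [AddCommGroup L₀] [Module R L₀]
    [AddCommGroup L₁] [Module R L₁] (i : M →ₗ[R] L₀) (p : L₀ →ₗ[R] L₁) :
    Subring (Module.End R L₀ × Module.End R M × Module.End R L₁) where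
  carrier := {t | (∀ x, t.1 (i x) = i (t.2.1 x)) ∧ ∀ x, p (t.1 x) = t.2.2 (p x)}
  mul_mem' := by
    rintro a b ⟨ha, ha2⟩ ⟨hb, hb2⟩
    exact ⟨fun x => by simp [ha, hb], fun x => by simp [ha2, hb2]⟩
  one_mem' := ⟨fun x => rfl, fun x => rfl⟩
  add_mem' := by
    rintro a b ⟨ha, ha2⟩ ⟨hb, hb2⟩
    exact ⟨fun x => by simp [ha, hb], fun x => by simp [ha2, hb2]⟩
  zero_mem' := ⟨fun x => by simp, fun x => by simp⟩
  neg_mem' := by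
    rintro a ⟨ha, ha2⟩
    exact ⟨fun x => by simp [ha], fun x => by simp [ha2]⟩


/-- Let `M` be a finitely copresented module, i.e. suppose there is an exact
sequence `0 → M → L₀ → L₁ → 0` with `L₀` injective and both `L₀` and `L₁` of finite Goldie
dimension. Then `End_R(M)` is semilocal. -/
theorem isSemilocalRing_end_of_finitelyCopresented {R M L₀ L₁ : Type*} [Ring R]
    [AddCommGroup M] [Module R M] [AddCommGroup L₀] [Module R L₀]
    [AddCommGroup L₁] [Module R L₁]
    (hL₀inj : Module.Injective R L₀)
    (hL₀dim : HasFiniteGoldieDimension R L₀) (hL₁dim : HasFiniteGoldieDimension R L₁)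
    (i : M →ₗ[R] L₀) (p : L₀ →ₗ[R] L₁)
    (hi : Function.Injective i) (hp : Function.Surjective p)
    (hexact : LinearMap.range i = LinearMap.ker p) :
    IsSemilocalRing (Module.End R M) := by
  have c0 := hL₀dim.chainCond
  have c1 := hL₁dim.chainCond
  have cM := c0.of_injective i hi
  have hpi : ∀ x, p (i x) = 0 := fun x => by
    have : i x ∈ LinearMap.range i := ⟨x, rfl⟩
    rw [hexact] at this
    exact this
  have hker : ∀ x, p x = 0 → ∃ m, i m = x := fun x hx => by
    have : x ∈ LinearMap.ker p := hx
    rw [← hexact] at this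
    exact this
  let φ : seqEnd i p →+* Module.End R M :=
    (RingHom.fst _ _).comp ((RingHom.snd _ _).comp (seqEnd i p).subtype)
  let ψ : seqEnd i p →+* Module.End R L₁ :=
    (RingHom.snd _ _).comp ((RingHom.snd _ _).comp (seqEnd i p).subtype)
  refine isSemilocalRing_of_chainCond cM c1 φ ψ φ ?_ ?_
  · intro f
    obtain ⟨g, hg⟩ := hL₀inj.out (LinearMap.range i).subtype (Submodule.subtype_injective _)
      ((i.comp f).comp (LinearEquiv.ofInjective i hi).symm.toLinearMap)
    have hgi : ∀ x, g (i x) = i (f x) := fun x => by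
      have := hg (LinearEquiv.ofInjective i hi x)
      simpa using this
    have hle : LinearMap.ker p ≤ LinearMap.ker (p.comp g) := by
      intro x hx
      obtain ⟨m, rfl⟩ := hker x hx
      rw [LinearMap.mem_ker, LinearMap.comp_apply, hgi, hpi]
    let f1 : Module.End R L₁ := ((LinearMap.ker p).liftQ (p.comp g) hle).comp
      (p.quotKerEquivOfSurjective hp).symm.toLinearMap
    have hf1 : ∀ x, p (g x) = f1 (p x) := fun x => by
      have : (p.quotKerEquivOfSurjective hp).symm (p x) = Submodule.Quotient.mk x := by
        rw [LinearEquiv.symm_apply_eq]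
        rfl
      change _ = ((LinearMap.ker p).liftQ (p.comp g) hle)
        ((p.quotKerEquivOfSurjective hp).symm (p x))
      rw [this]
      rfl
    exact ⟨⟨(g, f, f1), hgi, hf1⟩, rfl⟩
  · rintro ⟨⟨f0, f, f1⟩, h1, h2⟩ (hf : Function.Injective f) (hf1 : Function.Injective f1)
    change ∀ x, f0 (i x) = i (f x) at h1
    change ∀ x, p (f0 x) = f1 (p x) at h2
    have hk : ∀ x, p (f0 x) = 0 → ∃ m, i m = x := fun x hx => by
      apply hker
      apply hf1
      rw [← h2, hx, map_zero]
    have hf0 : Function.Injective f0 := by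
      rw [injective_iff_map_eq_zero]
      intro x hx
      obtain ⟨m, rfl⟩ := hk x (by rw [hx, map_zero])
      rw [h1] at hx
      have : f m = 0 := hi (by rw [hx, map_zero])
      have : m = 0 := hf (by rw [this, map_zero])
      rw [this, map_zero]
    have hs := surjective_of_chainCond c0 hL₀inj f0 hf0
    change IsUnit f
    rw [Module.End.isUnit_iff]
    refine ⟨hf, fun y => ?_⟩
    obtain ⟨x, hx⟩ := hs (i y)
    obtain ⟨m, rfl⟩ := hk x (by rw [hx, hpi])
    exact ⟨m, hi (by rw [← h1, hx])⟩
end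

section
/- Let R be a ring and let E be an injective R-module that is quotient finite dimensional, i.e., every quotient module of E has finite Goldie dimension. Then for every submodule M of E, the endomorphism ring End_R(M) is semilocal. -/
/-- The first submodule contains the second one `K` together with a nonzero submodule disjoint from `K`. -/
def GrowRel {R M : Type*} [Ring R] [AddCommGroup M] [Module R M]
    (K' K : Submodule R M) : Prop :=
  ∃ L : Submodule R M, L ≠ ⊥ ∧ Disjoint K L ∧ K ⊔ L ≤ K'

theorem growRel_wf {R M : Type*} [Ring R] [AddCommGroup M] [Module R M]
    (h : HasFiniteGoldieDimension R M) :
    WellFounded (GrowRel : Submodule R M → Submodule R M → Prop) := by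
  rw [wellFounded_iff_isEmpty_descending_chain]
  refine ⟨?_⟩
  rintro ⟨K, hK⟩
  choose L hL0 hLd hLle using hK
  have hmono : Monotone K := monotone_nat_of_le_succ fun n => le_sup_left.trans (hLle n)
  have hLK : ∀ {i n}, i < n → L i ≤ K n := fun {i n} hin =>
    (le_sup_right.trans (hLle i)).trans (hmono hin)
  have hind : iSupIndep L := by
    intro i
    let P : ℕ → Submodule R M := fun j => if j = i then ⊥ else L j
    have hP : ∀ n, partialSups P n ≤ K (n + 1) := by
      intro n
      refine partialSups_le _ _ _ fun j hj => ?_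
      by_cases hji : j = i
      · simp [P, hji]
      · simpa [P, hji] using hLK (Nat.lt_succ_of_le hj)
    have hdis : ∀ n, Disjoint (L i) (partialSups P n) := by
      intro n
      induction n with
      | zero =>
        rcases Nat.eq_zero_or_pos i with rfl | hi
        · simp [P]
        · exact ((hLd i).mono_left ((hP 0).trans (hmono hi))).symm
      | succ n ih =>
        rcases lt_trichotomy (n + 1) i with hlt | heq | hgt
        · exact ((hLd i).mono_left ((hP (n + 1)).trans (hmono hlt))).symm
        · have : partialSups P (n + 1) = partialSups P n := by
            rw [partialSups_add_one]
            simp [P, heq]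
          rw [this]; exact ih
        · have h2 : partialSups P (n + 1) = partialSups P n ⊔ L (n + 1) := by
            rw [partialSups_add_one]
            simp [P, hgt.ne']
          rw [h2]
          refine ih.disjoint_sup_right_of_disjoint_sup_left ?_
          exact (hLd (n + 1)).mono_left (sup_le (hLK hgt) (hP n))
    have hle : (⨆ (j) (_ : j ≠ i), L j) ≤ ⨆ n, partialSups P n := by
      refine iSup₂_le fun j hj => ?_
      refine le_trans ?_ (le_iSup _ j)
      have := le_partialSups P j
      simpa [P, hj] using this
    refine Disjoint.mono_right hle ?_
    exact ((partialSups P).monotone.directed_le.disjoint_iSup_right).2 hdis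
  have hfin := h (Set.range L) (by rintro _ ⟨n, rfl⟩; exact hL0 n)
    (fun N hN => (hind.sSupIndep_range hN).eq_bot)
  exact Set.infinite_range_of_injective (hind.injective hL0) hfin

theorem growRel_wf_of_equiv {R M N : Type*} [Ring R] [AddCommGroup M] [Module R M]
    [AddCommGroup N] [Module R N] (e : M ≃ₗ[R] N)
    (h : WellFounded (GrowRel : Submodule R N → Submodule R N → Prop)) :
    WellFounded (GrowRel : Submodule R M → Submodule R M → Prop) := by
  let o := Submodule.orderIsoMapComap e
  refine Subrelation.wf (r := InvImage GrowRel o) ?_ (InvImage.wf _ h)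
  rintro K' K ⟨L, h0, hd, hle⟩
  refine ⟨o L, ?_, ?_, ?_⟩
  · simpa using h0
  · simpa [disjoint_map_orderIso_iff] using hd
  · rw [← o.map_sup]; exact o.monotone hle

theorem surjective_of_injective_of_growRel {R : Type*} {E : Type*} [Ring R] [AddCommGroup E]
    [Module R E] (hE : Module.Injective R E)
    (h : WellFounded (GrowRel : Submodule R E → Submodule R E → Prop))
    (c : Module.End R E) (hc : Function.Injective c) : Function.Surjective c := by
  obtain ⟨p, hp⟩ := hE.out c hc LinearMap.id
  have hpn : ∀ n x, (p ^ n) ((c ^ n) x) = x := by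
    intro n
    induction n with
    | zero => simp
    | succ n ih =>
      intro x
      rw [pow_succ p, pow_succ' c, Module.End.mul_apply, Module.End.mul_apply, hp]
      exact ih x
  by_cases hk : LinearMap.ker p = ⊥
  · intro y
    refine ⟨p y, ?_⟩
    apply LinearMap.ker_eq_bot.1 hk
    rw [hp]; rfl
  exfalso
  refine (wellFounded_iff_isEmpty_descending_chain.1 h).elim
    ⟨fun n => LinearMap.ker (p ^ n), fun n => ?_⟩
  refine ⟨(LinearMap.ker p).map (c ^ n), ?_, ?_, ?_⟩
  · intro h0
    apply hk
    rw [eq_bot_iff]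
    intro x hx
    have : (c ^ n) x ∈ (LinearMap.ker p).map (c ^ n) := Submodule.mem_map_of_mem hx
    rw [h0, Submodule.mem_bot] at this
    have h1 := hpn n x
    rw [this, map_zero] at h1
    exact h1.symm
  · rw [Submodule.disjoint_def]
    rintro _ hx ⟨x, _, rfl⟩
    have h1 := hpn n x
    rw [LinearMap.mem_ker] at hx
    rw [hx] at h1
    rw [← h1, map_zero]
  · refine sup_le ?_ ?_
    · intro x hx
      rw [LinearMap.mem_ker] at hx ⊢
      rw [pow_succ', Module.End.mul_apply, hx, map_zero]
    · rintro _ ⟨x, hx, rfl⟩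
      rw [LinearMap.mem_ker, pow_succ', Module.End.mul_apply, hpn]
      exact hx

theorem ker_le_camps {R M : Type*} [Ring R] [AddCommGroup M] [Module R M]
    (a b : Module.End R M) : LinearMap.ker a ≤ LinearMap.ker (a - a * b * a) := by
  intro x hx
  rw [LinearMap.mem_ker] at hx ⊢
  simp [hx]

theorem growRel_camps {R M : Type*} [Ring R] [AddCommGroup M] [Module R M]
    (a b : Module.End R M) (h : LinearMap.ker (1 - b * a) ≠ ⊥) :
    GrowRel (LinearMap.ker (a - a * b * a)) (LinearMap.ker a) := by
  refine ⟨_, h, ?_, sup_le (ker_le_camps a b) ?_⟩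
  · rw [Submodule.disjoint_def]
    intro x hx hx'
    rw [LinearMap.mem_ker] at hx hx'
    simpa [hx] using hx'
  · intro x hx
    rw [LinearMap.mem_ker] at hx ⊢
    have : a - a * b * a = a * (1 - b * a) := by noncomm_ring
    rw [this, Module.End.mul_apply, hx, map_zero]

noncomputable def growRank {R M : Type*} [Ring R] [AddCommGroup M] [Module R M]
    (h : WellFounded (GrowRel : Submodule R M → Submodule R M → Prop)) (K : Submodule R M) :
    Ordinal :=
  (h.apply K).rank

theorem growRank_lt {R M : Type*} [Ring R] [AddCommGroup M] [Module R M]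
    (h : WellFounded (GrowRel : Submodule R M → Submodule R M → Prop)) {K' K : Submodule R M}
    (hr : GrowRel K' K) : growRank h K' < growRank h K :=
  Acc.rank_lt_of_rel _ hr

theorem growRank_le {R M : Type*} [Ring R] [AddCommGroup M] [Module R M]
    (h : WellFounded (GrowRel : Submodule R M → Submodule R M → Prop)) {K' K : Submodule R M}
    (hle : K ≤ K') : growRank h K' ≤ growRank h K := by
  unfold growRank
  rw [Acc.rank_eq]
  refine Ordinal.iSup_le ?_
  rintro ⟨K'', L, h0, hd, hL⟩
  rw [Order.succ_le_iff]
  refine Acc.rank_lt_of_rel (h.apply K) ?_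
  by_contra hcon
  exact hcon ⟨L, h0, hd.mono_left hle, (sup_le_sup_right hle _).trans hL⟩

/-- A version of the Camps–Dicks criterion. -/
theorem camps_dicks {S T A α : Type*} [Ring S] [Ring T] [Ring A] (π : S →+* T) (q : T →+* A)
    (hπ : Function.Surjective π) (hq : Function.Surjective q)
    (hker : ∀ x : T, (∀ y, IsUnit (1 - y * x)) → q x = 0)
    (r : α → α → Prop) (hr : WellFounded r) (f : S → α)
    (hf : ∀ a b : S, ¬ IsUnit (π (1 - b * a)) → r (f (a - a * b * a)) (f a)) :
    IsSemisimpleRing A := by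
  refine { exists_isCompl := fun I => ?_ }
  obtain ⟨a, ha, hmin⟩ := (InvImage.wf f hr).has_min {a : S | 1 - q (π a) ∈ I} ⟨1, by simp⟩
  rw [Set.mem_ofPred_eq] at ha
  refine ⟨Ideal.span {q (π a)}, ?_, ?_⟩
  · rw [Submodule.disjoint_def]
    intro x hxI hx
    obtain ⟨y, rfl⟩ := Ideal.mem_span_singleton'.1 hx
    obtain ⟨y, rfl⟩ := hq y
    obtain ⟨b, rfl⟩ := hπ y
    rw [← map_mul]
    apply hker
    intro z
    obtain ⟨z, rfl⟩ := hπ z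
    by_contra hu
    refine hmin (a - a * (z * b) * a) ?_ (hf a (z * b) ?_)
    · rw [Set.mem_ofPred_eq]
      have : 1 - q (π (a - a * (z * b) * a)) =
          (1 - q (π a)) + q (π (a * z)) * (q (π b) * q (π a)) := by
        simp only [map_sub, map_mul]
        noncomm_ring
      rw [this]
      exact I.add_mem ha (I.smul_mem _ hxI)
    · simpa [mul_assoc] using hu
  · rw [codisjoint_iff, Ideal.eq_top_iff_one]
    have : (1 : A) = (1 - q (π a)) + q (π a) := by abel
    rw [this]
    exact Submodule.add_mem_sup ha (Ideal.mem_span_singleton_self _)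

theorem mem_jacobson_of_isUnit {T : Type*} [Ring T] (x : T) (hx : ∀ y, IsUnit (1 - y * x)) :
    x ∈ TwoSidedIdeal.jacobson (⊥ : TwoSidedIdeal T) := by
  rw [TwoSidedIdeal.mem_jacobson_iff]
  intro y
  obtain ⟨u, hu⟩ := hx (-y)
  refine ⟨↑u⁻¹, ?_⟩
  rw [TwoSidedIdeal.mem_bot]
  have h3 : (↑u⁻¹ : T) * (1 - -y * x) = 1 := by rw [← hu]; exact u.inv_mul
  rw [neg_mul, sub_neg_eq_add, mul_add, mul_one, ← mul_assoc, add_comm] at h3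
  rw [h3, sub_self]

/-- Endomorphisms of `E` stabilizing `M`. -/
def stabSubring {R E : Type*} [Ring R] [AddCommGroup E] [Module R E] (M : Submodule R E) :
    Subring (Module.End R E) where
  carrier := {g | ∀ x ∈ M, g x ∈ M}
  mul_mem' := fun ha hb x hx => ha _ (hb x hx)
  one_mem' := fun _ hx => hx
  add_mem' := fun ha hb x hx => M.add_mem (ha x hx) (hb x hx)
  zero_mem' := fun _ _ => M.zero_mem
  neg_mem' := fun ha x hx => M.neg_mem (ha x hx)

/-- Restriction to `M`. -/
def stabRestrict {R E : Type*} [Ring R] [AddCommGroup E] [Module R E] (M : Submodule R E) :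
    stabSubring M →+* Module.End R M where
  toFun g := g.1.restrict g.2
  map_one' := rfl
  map_mul' _ _ := rfl
  map_zero' := rfl
  map_add' _ _ := rfl

/-- The induced map on `E ⧸ M`. -/
def stabQuot {R E : Type*} [Ring R] [AddCommGroup E] [Module R E] (M : Submodule R E) :
    stabSubring M →+* Module.End R (E ⧸ M) where
  toFun g := M.mapQ M g.1 g.2
  map_one' := by ext; rfl
  map_mul' _ _ := by ext; rfl
  map_zero' := by ext; rfl
  map_add' _ _ := by ext; rfl

/-- Let `E` be an injective module all of whose quotients have finite Goldie
dimension. Then every submodule of `E` has a semilocal endomorphism ring. -/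
theorem isSemilocalRing_end_submodule_of_qfd_injective {R E : Type*} [Ring R]
    [AddCommGroup E] [Module R E] (hEinj : Module.Injective R E)
    (hqfd : ∀ N : Submodule R E, HasFiniteGoldieDimension R (E ⧸ N)) :
    ∀ M : Submodule R E, IsSemilocalRing (Module.End R M) := by
  intro M
  have h1 : WellFounded (GrowRel : Submodule R E → Submodule R E → Prop) :=
    growRel_wf_of_equiv (Submodule.quotEquivOfEqBot ⊥ rfl).symm (growRel_wf (hqfd ⊥))
  have h2 := growRel_wf (hqfd M)
  unfold IsSemilocalRing
  refine camps_dicks (stabRestrict M)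
    ((TwoSidedIdeal.jacobson (⊥ : TwoSidedIdeal (Module.End R M))).ringCon.mk') ?_ ?_ ?_
    (Prod.Lex (· < ·) (· < ·)) (WellFounded.prod_lex Ordinal.lt_wf Ordinal.lt_wf)
    (fun g => (growRank h1 (LinearMap.ker g.1), growRank h2 (LinearMap.ker (stabQuot M g)))) ?_
  · intro g
    obtain ⟨k, hk⟩ := hEinj.out M.subtype M.injective_subtype (M.subtype ∘ₗ g)
    refine ⟨⟨k, fun x hx => ?_⟩, ?_⟩
    · have := hk ⟨x, hx⟩
      simp only [Submodule.subtype_apply, LinearMap.comp_apply] at this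
      rw [this]; exact (g ⟨x, hx⟩).2
    · ext x
      exact hk x
  · exact RingCon.mk'_surjective _
  · intro x hx
    have hxm := mem_jacobson_of_isUnit x hx
    rw [← TwoSidedIdeal.mem_ker, TwoSidedIdeal.ker_ringCon_mk']
    exact hxm
  · intro a b hu
    have key : LinearMap.ker (1 - b.1 * a.1) ≠ ⊥ ∨
        LinearMap.ker (1 - stabQuot M b * stabQuot M a) ≠ ⊥ := by
      by_contra hcon
      push Not at hcon
      obtain ⟨hk1, hk2⟩ := hcon
      apply hu
      rw [Module.End.isUnit_iff]
      have hinj := LinearMap.ker_eq_bot.1 hk1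
      have hsurj := surjective_of_injective_of_growRel hEinj h1 _ hinj
      constructor
      · intro x y hxy
        exact Subtype.ext (hinj (congrArg Subtype.val hxy))
      · intro y
        obtain ⟨x, hx⟩ := hsurj y.1
        have hxM : x ∈ M := by
          rw [← Submodule.Quotient.mk_eq_zero]
          apply LinearMap.ker_eq_bot.1 hk2
          rw [map_zero]
          have : (1 - stabQuot M b * stabQuot M a) (Submodule.Quotient.mk x) =
              Submodule.Quotient.mk ((1 - b.1 * a.1) x) := rfl
          rw [this, hx, Submodule.Quotient.mk_eq_zero]
          exact y.2
        exact ⟨⟨x, hxM⟩, Subtype.ext hx⟩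
    have e1 : (a - a * b * a).1 = a.1 - a.1 * b.1 * a.1 := rfl
    have e2 : stabQuot M (a - a * b * a) =
        stabQuot M a - stabQuot M a * stabQuot M b * stabQuot M a := by
      simp only [map_sub, map_mul]
    rw [e1, e2]
    by_cases hk : LinearMap.ker (1 - b.1 * a.1) = ⊥
    · have hl := growRank_lt h2 (growRel_camps _ _ (key.resolve_left (not_not.2 hk)))
      rw [Prod.lex_def]
      rcases (growRank_le h1 (ker_le_camps a.1 b.1)).lt_or_eq with h | h
      · exact Or.inl h
      · exact Or.inr ⟨h, hl⟩
    · exact Prod.Lex.left _ _ (growRank_lt h1 (growRel_camps _ _ hk))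
end

section
/- Let R be a commutative noetherian semilocal integral domain of Krull dimension 1, let S be an R-algebra, and let M be an S-module which, as an R-module, is torsion-free of finite rank (i.e., rm = 0 with r ∈ R, m ∈ M implies r = 0 or m = 0, and every R-linearly independent subset of M is finite). Then the endomorphism ring End_S(M) is semilocal. -/
/-- `r`-multiples quotient. -/
abbrev smulQuot {R : Type*} [CommRing R] (r : R) (N : Type*) [AddCommGroup N] [Module R N] :=
  N ⧸ LinearMap.range (r • LinearMap.id : N →ₗ[R] N)

lemma isFiniteLength_of_smul_eq_zero {R N : Type*} [CommRing R] [IsDomain R] [IsNoetherianRing R]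
    [Ring.KrullDimLE 1 R] [AddCommGroup N] [Module R N] [Module.Finite R N] (s : R) (hs : s ≠ 0)
    (h : ∀ x : N, s • x = 0) : IsFiniteLength R N := by
  obtain ⟨n, f, hf⟩ := Module.Finite.exists_fin' R N
  have h1 : IsFiniteLength R (R ⧸ Ideal.span {s}) :=
    isFiniteLength_quotient_span_singleton R (mem_nonZeroDivisors_of_ne_zero hs)
  rw [isFiniteLength_iff_isNoetherian_isArtinian] at h1 ⊢
  obtain ⟨_, _⟩ := h1
  refine ⟨inferInstance, ?_⟩
  let g : (i : Fin n) → (R ⧸ Ideal.span {s}) →ₗ[R] N := fun i =>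
    Submodule.liftQ (Ideal.span {s}) (LinearMap.toSpanSingleton R N (f (Pi.single i 1))) (by
      rw [Ideal.span, Submodule.span_le]
      rintro x rfl
      simp [h])
  let G : (Fin n → R ⧸ Ideal.span {s}) →ₗ[R] N := LinearMap.lsum R _ R g
  refine isArtinian_of_surjective _ G ?_
  intro y
  obtain ⟨v, rfl⟩ := hf y
  refine ⟨fun i => Submodule.Quotient.mk (v i), ?_⟩
  have : v = ∑ i, v i • (Pi.single i 1 : Fin n → R) := by
    ext j; simp [Pi.single_apply]
  conv_rhs => rw [this]
  simp only [G, g, LinearMap.lsum_apply, map_sum, map_smul, LinearMap.sum_apply, LinearMap.comp_apply, LinearMap.proj_apply]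
  rfl

lemma length_smulQuot_add {R F N : Type*} [CommRing R] [AddCommGroup N] [Module R N]
    [AddCommGroup F] [Module R F] (g : F →ₗ[R] N) (hg : Function.Injective g) (r : R)
    (hr : ∀ x : N, r • x = 0 → x = 0) :
    Module.length R (N ⧸ LinearMap.range g) + Module.length R (smulQuot r N) =
    Module.length R (smulQuot r F) + Module.length R (N ⧸ LinearMap.range g) := by
  let P : Submodule R N := LinearMap.range (r • g)
  have hP1 : P ≤ LinearMap.range g := by
    rintro _ ⟨x, rfl⟩; exact ⟨r • x, by simp⟩
  have hP2 : P ≤ LinearMap.range (r • LinearMap.id : N →ₗ[R] N) := by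
    rintro _ ⟨x, rfl⟩; exact ⟨g x, by simp⟩
  have hinj : ∀ x y : N, r • x = r • y → x = y := fun x y h => by
    rw [← sub_eq_zero]; apply hr; rw [smul_sub, h, sub_self]
  rw [← Module.length_eq_add_of_exact
    (Submodule.mapQ (LinearMap.range g) P (r • LinearMap.id) (by
      rintro _ ⟨x, rfl⟩; exact ⟨x, by simp⟩)) (Submodule.factor hP2) ?_
      (Submodule.factor_surjective hP2) ?_,
    ← Module.length_eq_add_of_exact
    (Submodule.mapQ (LinearMap.range (r • LinearMap.id : F →ₗ[R] F)) P g (by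
      rintro _ ⟨x, rfl⟩; exact ⟨x, by simp⟩)) (Submodule.factor hP1) ?_
      (Submodule.factor_surjective hP1) ?_]
  · rw [injective_iff_map_eq_zero]
    intro x
    induction x using Submodule.Quotient.induction_on with | _ x
    simp only [Submodule.mapQ_apply, Submodule.Quotient.mk_eq_zero]
    rintro ⟨y, hy⟩
    refine ⟨y, hg ?_⟩
    simpa using hy
  · intro x
    induction x using Submodule.Quotient.induction_on with | _ x
    change Submodule.Quotient.mk x = 0 ↔ _
    rw [Submodule.Quotient.mk_eq_zero]
    constructor
    · rintro ⟨y, rfl⟩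
      exact ⟨Submodule.Quotient.mk y, by simp⟩
    · rintro ⟨y, hy⟩
      induction y using Submodule.Quotient.induction_on with | _ y
      rw [Submodule.mapQ_apply, Submodule.Quotient.eq] at hy
      have := Submodule.sub_mem _ (LinearMap.mem_range_self g y) (hP1 hy)
      simpa using this
  · rw [injective_iff_map_eq_zero]
    intro x
    induction x using Submodule.Quotient.induction_on with | _ x
    simp only [Submodule.mapQ_apply, Submodule.Quotient.mk_eq_zero]
    rintro ⟨y, hy⟩
    refine ⟨y, hinj _ _ ?_⟩
    simpa using hy
  · intro x
    induction x using Submodule.Quotient.induction_on with | _ x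
    change Submodule.Quotient.mk x = 0 ↔ _
    rw [Submodule.Quotient.mk_eq_zero]
    constructor
    · rintro ⟨y, rfl⟩
      exact ⟨Submodule.Quotient.mk y, by simp⟩
    · rintro ⟨y, hy⟩
      induction y using Submodule.Quotient.induction_on with | _ y
      rw [Submodule.mapQ_apply, Submodule.Quotient.eq] at hy
      have := Submodule.sub_mem _ (LinearMap.mem_range_self (r • LinearMap.id : N →ₗ[R] N) y) (hP2 hy)
      simpa using this

/-- A module whose f.g. submodules have bounded length has finite length. -/
lemma isFiniteLength_of_fg_bounded {R Q : Type*} [CommRing R] [AddCommGroup Q] [Module R Q] (n : ℕ)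
    (h : ∀ L : Submodule R Q, L.FG → Module.length R L ≤ n) : IsFiniteLength R Q := by
  -- take an f.g. submodule of maximal length
  let A : Set ℕ∞ := {k | ∃ L : Submodule R Q, L.FG ∧ Module.length R L = k}
  suffices (⊤ : Submodule R Q).FG by
    have := h _ this
    rw [Module.length_top] at this
    rw [← Module.length_ne_top_iff]
    exact ne_top_of_le_ne_top (ENat.natCast_ne_top n) this
  obtain ⟨L, hL, hmax⟩ : ∃ L : Submodule R Q, L.FG ∧ ∀ L' : Submodule R Q, L'.FG →
      Module.length R L' ≤ Module.length R L := by
    by_contra! hcon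
    have : ∀ k : ℕ, ∃ L : Submodule R Q, L.FG ∧ (k : ℕ∞) ≤ Module.length R L := by
      intro k
      induction k with
      | zero => exact ⟨⊥, Submodule.fg_bot, by simp⟩
      | succ k ih =>
        obtain ⟨L, hL, hk⟩ := ih
        obtain ⟨L', hL', hlt⟩ := hcon L hL
        exact ⟨L', hL', by push_cast; exact Order.add_one_le_of_lt (hk.trans_lt hlt)⟩
    obtain ⟨L, hL, hk⟩ := this (n + 1)
    have := hk.trans (h L hL)
    norm_cast at this
    omega
  convert hL
  rw [eq_comm, eq_top_iff]
  intro x _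
  by_contra hx
  let L' := L ⊔ Submodule.span R {x}
  have hL' : L'.FG := hL.sup (Submodule.fg_span_singleton x)
  have hfin : IsFiniteLength R L' := by
    rw [← Module.length_ne_top_iff]
    exact ne_top_of_le_ne_top (ENat.natCast_ne_top n) (h _ hL')
  rw [isFiniteLength_iff_isNoetherian_isArtinian] at hfin
  obtain ⟨_, _⟩ := hfin
  have hle : L ≤ L' := le_sup_left
  have hne : L.submoduleOf L' ≠ ⊤ := by
    intro htop
    rw [Submodule.submoduleOf_eq_top] at htop
    exact hx (htop (Submodule.mem_sup_right (Submodule.mem_span_singleton_self x)))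
  have := Submodule.length_lt hne
  rw [(Submodule.submoduleOfEquivOfLe hle).length_eq] at this
  exact absurd (hmax L' hL') (not_le.mpr this)

lemma isFiniteLength_smulQuot {R M : Type*} [CommRing R] [IsDomain R] [IsNoetherianRing R]
    [Ring.KrullDimLE 1 R] [AddCommGroup M] [Module R M]
    (htf : ∀ (r : R) (m : M), r • m = 0 → r = 0 ∨ m = 0) (F : Submodule R M) (hF : F.FG)
    (hFM : ∀ x : M, ∃ a : R, a ≠ 0 ∧ a • x ∈ F) (r : R) (hr : r ≠ 0) :
    IsFiniteLength R (smulQuot r M) := by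
  have hr' : ∀ x : M, r • x = 0 → x = 0 := fun x hx => (htf r x hx).resolve_left hr
  have : Module.Finite R F := Module.Finite.iff_fg.mpr hF
  have hFfin : IsFiniteLength R (smulQuot r F) := by
    refine isFiniteLength_of_smul_eq_zero r hr fun x => ?_
    induction x using Submodule.Quotient.induction_on with | _ x
    rw [← Submodule.Quotient.mk_smul, Submodule.Quotient.mk_eq_zero]
    exact ⟨x, by simp⟩
  rw [← Module.length_ne_top_iff] at hFfin
  obtain ⟨n, hn⟩ := ENat.ne_top_iff_exists.mp hFfin
  refine isFiniteLength_of_fg_bounded n fun L hL => ?_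
  -- lift `L`
  obtain ⟨N₀, hN₀, hN₀L⟩ : ∃ N₀ : Submodule R M, N₀.FG ∧
      N₀.map (LinearMap.range (r • LinearMap.id : M →ₗ[R] M)).mkQ = L := by
    obtain ⟨t, rfl⟩ := hL
    choose σ hσ using Submodule.mkQ_surjective (LinearMap.range (r • LinearMap.id : M →ₗ[R] M))
    classical
    refine ⟨Submodule.span R (t.image σ), ⟨_, rfl⟩, ?_⟩
    rw [Submodule.map_span]
    congr 1
    ext x
    have hσ' : ∀ b, Submodule.Quotient.mk (σ b) = b := hσ
    simp [hσ']
  let N := F ⊔ N₀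
  have hN : N.FG := hF.sup hN₀
  have : Module.Finite R N := Module.Finite.iff_fg.mpr hN
  have hFN : F ≤ N := le_sup_left
  let g := Submodule.inclusion hFN
  have key := length_smulQuot_add g (Submodule.inclusion_injective hFN) r
    (fun x hx => Subtype.ext (hr' x (by simpa using congrArg Subtype.val hx)))
  -- `N / F` has finite length
  have hNF : IsFiniteLength R (N ⧸ LinearMap.range g) := by
    obtain ⟨t, ht⟩ := Module.Finite.fg_top (R := R) (M := N)
    choose a ha haF using hFM
    refine isFiniteLength_of_smul_eq_zero (∏ x ∈ t, a x)
      (Finset.prod_ne_zero_iff.mpr fun x _ => ha x) fun x => ?_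
    induction x using Submodule.Quotient.induction_on with | _ x
    have hx : x ∈ Submodule.span R (t : Set N) := ht ▸ Submodule.mem_top
    rw [← Submodule.Quotient.mk_smul, Submodule.Quotient.mk_eq_zero]
    have hle : Submodule.span R (t : Set N) ≤ (LinearMap.range g).comap
        ((∏ x ∈ t, a x) • LinearMap.id : N →ₗ[R] N) := by
      rw [Submodule.span_le]
      intro y hy
      obtain ⟨b, hb⟩ := Finset.dvd_prod_of_mem (fun x : N => a x) hy
      rw [SetLike.mem_coe, Submodule.mem_comap]
      refine ⟨⟨(∏ x ∈ t, a x) • (y : M), ?_⟩, by ext; simp [g]⟩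
      rw [hb, mul_comm, mul_smul]
      exact F.smul_mem _ (haF _)
    simpa using hle hx
  rw [← Module.length_ne_top_iff] at hNF
  rw [add_comm, ← hn] at key
  have key2 := (ENat.add_left_injective_of_ne_top hNF) key
  rw [← key2]
  -- `N / rN` surjects onto a module containing `L`
  let q : smulQuot r N →ₗ[R] smulQuot r M := Submodule.mapQ _ _ N.subtype (by
    rintro _ ⟨x, rfl⟩; exact ⟨x, by simp⟩)
  have hLq : L ≤ LinearMap.range q := by
    rw [← hN₀L]
    rintro _ ⟨x, hx, rfl⟩
    exact ⟨Submodule.Quotient.mk ⟨x, Submodule.mem_sup_right hx⟩, by simp [q]⟩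
  exact (Module.length_le_of_injective _ (Submodule.inclusion_injective hLq)).trans
    (Module.length_le_of_surjective _ q.surjective_rangeRestrict)

/-- Finite intersections suffice. -/
lemma exists_finset_inf {A R P : Type*} [Ring A] [Ring R] [AddCommGroup P] [Module R P]
    [IsArtinian R P] (h : A → P) (𝒮 : Set (Ideal A))
    (H : ∀ m ∈ 𝒮, ∃ W : Submodule R P, ∀ a, a ∈ m ↔ h a ∈ W) :
    ∃ t : Finset (Ideal A), (∀ m ∈ t, m ∈ 𝒮) ∧ ∀ a, (∀ m ∈ t, a ∈ m) → ∀ m ∈ 𝒮, a ∈ m := by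
  classical
  choose W hW using H
  obtain ⟨s, hs⟩ := Finset.exists_inf_le (fun m : 𝒮 => W m.1 m.2)
  refine ⟨s.image Subtype.val, ?_, ?_⟩
  · intro m hm
    obtain ⟨x, _, rfl⟩ := Finset.mem_image.mp hm
    exact x.2
  · intro a ha m hm
    rw [hW m hm]
    refine hs ⟨m, hm⟩ (Submodule.mem_finsetInf.mpr fun i hi => ?_)
    rw [← hW]
    exact ha _ (Finset.mem_image_of_mem _ hi)

lemma isSemilocalRing_of_finset {A : Type*} [Ring A] (t : Finset (Ideal A))
    (ht : ∀ m ∈ t, m.IsMaximal)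
    (hJ : ∀ a, (∀ m ∈ t, a ∈ m) → ∀ m : Ideal A, m.IsMaximal → a ∈ m) : IsSemilocalRing A := by
  unfold IsSemilocalRing
  set c := (TwoSidedIdeal.jacobson (⊥ : TwoSidedIdeal A)).ringCon
  let π : A →+* c.Quotient := c.mk'
  have hπ : Function.Surjective π := c.mk'_surjective
  have hker : ∀ a, π a = 0 ↔ ∀ m : Ideal A, m.IsMaximal → a ∈ m := by
    intro a
    have h1 : π a = 0 ↔ a ∈ TwoSidedIdeal.asIdeal (TwoSidedIdeal.jacobson (⊥ : TwoSidedIdeal A)) := by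
      rw [TwoSidedIdeal.mem_asIdeal, TwoSidedIdeal.mem_iff]
      exact RingCon.eq c
    rw [h1, TwoSidedIdeal.asIdeal_jacobson, Ideal.jacobson, Submodule.mem_sInf]
    constructor
    · intro h m hm
      refine h m ⟨?_, hm⟩
      intro x hx
      have : x = 0 := by simpa using hx
      simp [this]
    · rintro h m ⟨_, hm⟩
      exact h m hm
  have _ (m : t) : IsSimpleModule A (A ⧸ m.1) := isSimpleModule_iff_isCoatom.mpr (ht m.1 m.2).1
  let f : A →ₗ[A] ∀ m : t, A ⧸ m.1 := LinearMap.pi fun m ↦ m.1.mkQ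
  let J : Ideal A := RingHom.ker π
  have hf : ∀ a, f a = 0 ↔ a ∈ J := by
    intro a
    rw [RingHom.mem_ker, hker]
    constructor
    · intro h
      refine hJ a fun m hm => ?_
      exact (Submodule.Quotient.mk_eq_zero m).mp (congr_fun h ⟨m, hm⟩)
    · intro h
      funext m
      exact (Submodule.Quotient.mk_eq_zero m.1).mpr (h m.1 (ht m.1 m.2))
  have hss : IsSemisimpleModule A (A ⧸ J) := by
    refine .of_injective (Submodule.liftQ J f fun a ha => (hf a).2 ha) ?_
    rw [injective_iff_map_eq_zero]
    intro x
    induction x using Submodule.Quotient.induction_on with | _ x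
    rw [Submodule.Quotient.mk_eq_zero]
    exact (hf x).1
  have : RingHomSurjective π := ⟨hπ⟩
  let π' : A →ₛₗ[π] c.Quotient := { toFun := π, map_add' := map_add π, map_smul' := fun a b => by simp }
  let l : (A ⧸ J) →ₛₗ[π] c.Quotient := Submodule.liftQ J π' (fun a ha => ha)
  refine (l.isSemisimpleModule_iff_of_bijective ⟨?_, ?_⟩).mp hss
  · rw [injective_iff_map_eq_zero]
    intro x
    induction x using Submodule.Quotient.induction_on with | _ x
    rw [Submodule.Quotient.mk_eq_zero]
    exact fun h => h
  · intro y
    obtain ⟨a, rfl⟩ := hπ y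
    exact ⟨Submodule.Quotient.mk a, rfl⟩

lemma exists_ne_zero_mem_maximal {R : Type*} [CommRing R] [IsDomain R]
    (hR : IsSemilocalRing R) (hdim : ringKrullDim R = 1) :
    ∃ r : R, r ≠ 0 ∧ ∀ m : Ideal R, m.IsMaximal → r ∈ m := by
  by_contra! hcon
  unfold IsSemilocalRing at hR
  set c := (TwoSidedIdeal.jacobson (⊥ : TwoSidedIdeal R)).ringCon
  let π : R →+* c.Quotient := c.mk'
  have hπ : Function.Surjective π := c.mk'_surjective
  have hinj : Function.Injective π := by
    rw [injective_iff_map_eq_zero]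
    intro a ha
    have h1 : a ∈ TwoSidedIdeal.asIdeal (TwoSidedIdeal.jacobson (⊥ : TwoSidedIdeal R)) := by
      rw [TwoSidedIdeal.mem_asIdeal, TwoSidedIdeal.mem_iff]
      exact (RingCon.eq c).mp ha
    rw [TwoSidedIdeal.asIdeal_jacobson, Ideal.jacobson, Submodule.mem_sInf] at h1
    by_contra hne
    obtain ⟨m, hm, ham⟩ := hcon a hne
    refine ham (h1 m ⟨?_, hm⟩)
    intro x hx
    have : x = 0 := by simpa using hx
    simp [this]
  let e : R ≃+* c.Quotient := RingEquiv.ofBijective π ⟨hinj, hπ⟩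
  have : IsSemisimpleRing R := e.symm.isSemisimpleRing
  have hf : IsField R := IsArtinianRing.isField_of_isDomain R
  have := ringKrullDim_eq_zero_of_isField hf
  rw [hdim] at this
  exact one_ne_zero this

lemma exists_pow_mem_span {R : Type*} [CommRing R] [IsDomain R] [Ring.KrullDimLE 1 R]
    (r : R) (hr : ∀ m : Ideal R, m.IsMaximal → r ∈ m) (t : R) (ht : t ≠ 0) :
    ∃ k : ℕ, ∃ c : R, r ^ k = c * t := by
  have : r ∈ (Ideal.span {t}).radical := by
    rw [Ideal.radical_eq_sInf, Submodule.mem_sInf]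
    rintro p ⟨hp, hpp⟩
    have : Ring.DimensionLEOne R := 
      ⟨fun {p} hp hpp => Ring.krullDimLE_one_iff_of_noZeroDivisors.mp ‹_› p hp hpp⟩
    apply hr
    refine hpp.isMaximal ?_
    rintro rfl
    exact ht (by simpa using hp)
  obtain ⟨k, hk⟩ := this
  rw [Ideal.mem_span_singleton'] at hk
  obtain ⟨c, hc⟩ := hk
  exact ⟨k, c, hc.symm⟩

/-- Let `R` be a commutative noetherian semilocal integral domain of Krull
dimension `1`, `S` an `R`-algebra and `M` an `S`-module that, as an `R`-module, is
torsion-free of finite rank (every `R`-linearly independent subset of `M` is finite).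
Then `End_S(M)` is semilocal. -/
theorem isSemilocalRing_end_torsionFree_finiteRank {R S M : Type*} [CommRing R] [IsDomain R]
    [IsNoetherianRing R] (hR : IsSemilocalRing R) (hdim : ringKrullDim R = 1)
    [Ring S] [Algebra R S] [AddCommGroup M] [Module S M] [Module R M] [IsScalarTower R S M]
    (htf : ∀ (r : R) (m : M), r • m = 0 → r = 0 ∨ m = 0)
    (hfr : ∀ s : Set M, LinearIndependent R ((↑) : s → M) → s.Finite) :
    IsSemilocalRing (Module.End S M) := by
  classical
  have : Ring.KrullDimLE 1 R := by
    rw [Ring.KrullDimLE, Order.krullDimLE_iff]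
    exact hdim.le
  obtain ⟨r, hr0, hr⟩ := exists_ne_zero_mem_maximal hR hdim
  have : SMulCommClass S R M := inferInstance
  have hrM : ∀ x y : M, r • x = r • y → x = y := fun x y h => by
    rw [← sub_eq_zero]
    exact (htf r _ (by rw [smul_sub, h, sub_self])).resolve_left hr0
  -- a maximal independent set
  obtain ⟨s, hs, hsmax⟩ := exists_maximal_linearIndepOn R (id : M → M)
  have hsfin : s.Finite := hfr s hs
  have := hsfin.to_subtype
  have hsM : ∀ x : M, ∃ a : R, a ≠ 0 ∧ a • x ∈ Submodule.span R s := by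
    intro x
    by_cases hx : x ∈ s
    · exact ⟨1, one_ne_zero, by simpa using Submodule.subset_span hx⟩
    · simpa using hsmax x hx
  have hfl := isFiniteLength_smulQuot htf (Submodule.span R s) (Submodule.fg_span hsfin) hsM r hr0
  rw [isFiniteLength_iff_isNoetherian_isArtinian] at hfl
  obtain ⟨_, _⟩ := hfl
  -- left ideals are `R`-stable
  have hsm : ∀ (m : Ideal (Module.End S M)) (c : R) (a : Module.End S M), a ∈ m → c • a ∈ m := by
    intro m c a ha
    have : c • a = (c • (1 : Module.End S M)) * a := by ext; simp
    rw [this]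
    exact m.mul_mem_left _ ha
  -- part one
  obtain ⟨t₁, ht₁, hJ₁⟩ : ∃ t : Finset (Ideal (Module.End S M)),
      (∀ m ∈ t, m ∈ {m : Ideal (Module.End S M) | m.IsMaximal ∧ r • (1 : Module.End S M) ∈ m}) ∧
      ∀ a, (∀ m ∈ t, a ∈ m) →
        ∀ m ∈ {m : Ideal (Module.End S M) | m.IsMaximal ∧ r • (1 : Module.End S M) ∈ m}, a ∈ m := by
    obtain ⟨u, hu⟩ := Module.Finite.fg_top (R := R) (M := smulQuot r M)
    choose σ hσ using Submodule.mkQ_surjective (LinearMap.range (r • LinearMap.id : M →ₗ[R] M))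
    let h : Module.End S M → (u → smulQuot r M) := fun a i =>
      Submodule.Quotient.mk (a (σ i.1))
    have hker : ∀ a, h a = 0 → ∃ c : Module.End S M, a = r • c := by
      intro a ha
      have hle : LinearMap.range (r • LinearMap.id : M →ₗ[R] M) ≤
          (LinearMap.range (r • LinearMap.id : M →ₗ[R] M)).comap (a.restrictScalars R) := by
        rintro _ ⟨x, rfl⟩
        exact ⟨a x, by simp⟩
      let abar : smulQuot r M →ₗ[R] smulQuot r M := Submodule.mapQ _ _ (a.restrictScalars R) hle
      have habar : abar = 0 := by
        refine LinearMap.ext_on (s := (u : Set (smulQuot r M))) hu ?_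
        intro x hx
        have := congrFun ha ⟨x, hx⟩
        rw [← hσ x]
        exact this
      have hdiv : ∀ x : M, ∃ y : M, r • y = a x := by
        intro x
        have : abar (Submodule.Quotient.mk x) = 0 := by rw [habar]; rfl
        rw [Submodule.mapQ_apply, Submodule.Quotient.mk_eq_zero] at this
        obtain ⟨y, hy⟩ := this
        exact ⟨y, by simpa using hy⟩
      choose b hb using hdiv
      refine ⟨{ toFun := b, map_add' := ?_, map_smul' := ?_ }, ?_⟩
      · intro x y
        apply hrM
        rw [smul_add, hb, hb, hb, map_add]
      · intro z x
        apply hrM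
        rw [hb, RingHom.id_apply, smul_comm r z, hb, map_smul]
      · ext x
        simp [hb]
    refine exists_finset_inf (R := R) h _ ?_
    rintro m ⟨hm, hrm⟩
    refine ⟨{ carrier := h '' m, add_mem' := ?_, zero_mem' := ⟨0, m.zero_mem, rfl⟩, smul_mem' := ?_ }, ?_⟩
    · rintro _ _ ⟨a, ha, rfl⟩ ⟨b, hb, rfl⟩
      exact ⟨a + b, m.add_mem ha hb, rfl⟩
    · rintro c _ ⟨a, ha, rfl⟩
      exact ⟨c • a, hsm m c a ha, rfl⟩
    · intro a
      refine ⟨fun ha => ⟨a, ha, rfl⟩, ?_⟩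
      rintro ⟨b, hb, hab⟩
      obtain ⟨c, hc⟩ := hker (a - b) (by
        have : h (a - b) = h a - h b := rfl
        rw [this, hab, sub_self])
      have h1 : a = b + c * (r • 1) := by
        rw [mul_smul_comm, mul_one, ← hc]; abel
      rw [h1]
      exact m.add_mem hb (m.mul_mem_left _ hrm)
  -- part two
  obtain ⟨t₂, ht₂, hJ₂⟩ : ∃ t : Finset (Ideal (Module.End S M)),
      (∀ m ∈ t, m ∈ {m : Ideal (Module.End S M) | m.IsMaximal ∧ r • (1 : Module.End S M) ∉ m}) ∧
      ∀ a, (∀ m ∈ t, a ∈ m) →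
        ∀ m ∈ {m : Ideal (Module.End S M) | m.IsMaximal ∧ r • (1 : Module.End S M) ∉ m}, a ∈ m := by
    let K := FractionRing R
    let V := LocalizedModule (nonZeroDivisors R) M
    let ι : M →ₗ[R] V := LocalizedModule.mkLinearMap (nonZeroDivisors R) M
    have hι : Function.Injective ι := by
      rw [injective_iff_map_eq_zero]
      intro x hx
      obtain ⟨c, hc⟩ := (IsLocalizedModule.eq_zero_iff (nonZeroDivisors R) ι).mp hx
      exact (htf c x hc).resolve_left (nonZeroDivisors.ne_zero c.2)
    have hVfin : Module.Finite K V := by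
      refine ⟨⟨(hsfin.image ι).toFinset, ?_⟩⟩
      rw [Set.Finite.coe_toFinset, eq_top_iff]
      intro x _
      obtain ⟨⟨y, d⟩, hy⟩ := IsLocalizedModule.surj (nonZeroDivisors R) ι x
      obtain ⟨a, ha, hay⟩ := hsM y
      have h1 : ι (a • y) ∈ Submodule.span K (ι '' s) := by
        have : ι (a • y) ∈ Submodule.span R (ι '' s) := by
          rw [← Submodule.map_span]
          exact Submodule.mem_map_of_mem hay
        exact Submodule.span_le_restrictScalars R K _ this
      have hd : (d : R) ≠ 0 := nonZeroDivisors.ne_zero d.2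
      have h2 : algebraMap R K (a * d) ≠ 0 := by
        rw [Ne, FaithfulSMul.algebraMap_eq_zero_iff]
        exact mul_ne_zero ha hd
      have h3 : ι (a • y) = algebraMap R K (a * d) • x := by
        rw [map_smul, algebraMap_smul, mul_smul, ← hy]
        rfl
      rw [h3] at h1
      exact (Submodule.smul_mem_iff _ h2).mp h1
    let h : Module.End S M → (s → V) := fun a i => ι (a i.1)
    have hinj : ∀ a b : Module.End S M, h a = h b → a = b := by
      intro a b hab
      have h1 : ∀ x ∈ Submodule.span R s, (a.restrictScalars R) x = (b.restrictScalars R) x := by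
        have : Submodule.span R s ≤ LinearMap.eqLocus (a.restrictScalars R) (b.restrictScalars R) := by
          rw [Submodule.span_le]
          intro x hx
          exact hι (congrFun hab ⟨x, hx⟩)
        exact fun x hx => this hx
      ext x
      obtain ⟨c, hc, hcx⟩ := hsM x
      have h2 := h1 _ hcx
      rw [map_smul, map_smul] at h2
      rw [← sub_eq_zero]
      refine (htf c _ ?_).resolve_left hc
      rw [smul_sub, sub_eq_zero]
      exact h2
    refine exists_finset_inf (R := K) h _ ?_
    rintro m ⟨hm, hrm⟩
    have hr1 : ∀ a : Module.End S M, r • a ∈ m → a ∈ m := by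
      let I : Ideal (Module.End S M) :=
        { carrier := {a | r • a ∈ m}
          add_mem' := fun {a b} ha hb => by
            change r • (a + b) ∈ m
            rw [smul_add]; exact m.add_mem ha hb
          zero_mem' := by
            change r • (0 : Module.End S M) ∈ m
            rw [smul_zero]; exact m.zero_mem
          smul_mem' := fun c a ha => by
            change r • (c * a) ∈ m
            rw [← mul_smul_comm]; exact m.mul_mem_left _ ha }
      have hmI : m ≤ I := fun a ha => hsm m r a ha
      have hI : I ≠ ⊤ := by
        intro hI
        have : (1 : Module.End S M) ∈ I := hI ▸ Submodule.mem_top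
        exact hrm this
      have := hm.eq_of_le hI hmI
      intro a ha
      rw [this]
      exact ha
    have hrk : ∀ (k : ℕ) (a : Module.End S M), r ^ k • a ∈ m → a ∈ m := by
      intro k
      induction k with
      | zero => intro a ha; simpa using ha
      | succ k ih =>
        intro a ha
        rw [pow_succ, mul_smul] at ha
        exact hr1 _ (ih _ ha)
    refine ⟨Submodule.span K (h '' m), fun a => ⟨fun ha => Submodule.subset_span ⟨a, ha, rfl⟩, ?_⟩⟩
    intro ha
    have key : ∀ x ∈ Submodule.span K (h '' m), ∃ t : R, t ≠ 0 ∧ ∃ b ∈ m, t • x = h b := by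
      intro x hx
      induction hx using Submodule.span_induction with
      | mem x hx =>
        obtain ⟨b, hb, rfl⟩ := hx
        exact ⟨1, one_ne_zero, b, hb, one_smul _ _⟩
      | zero => exact ⟨1, one_ne_zero, 0, m.zero_mem, by ext i; simp [h]⟩
      | add x y _ _ hx hy =>
        obtain ⟨t, ht, b, hb, hx⟩ := hx
        obtain ⟨t', ht', b', hb', hy⟩ := hy
        refine ⟨t * t', mul_ne_zero ht ht', t' • b + t • b', m.add_mem (hsm m _ _ hb) (hsm m _ _ hb'), ?_⟩
        have e1 : h (t' • b + t • b') = t' • h b + t • h b' := by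
          funext i; simp [h]
        rw [e1, ← hx, ← hy, smul_add, smul_smul, smul_smul, mul_comm t' t]
      | smul k x _ hx =>
        obtain ⟨t, ht, b, hb, hx⟩ := hx
        obtain ⟨p, q, hq, rfl⟩ := IsFractionRing.div_surjective (A := R) k
        have hq0 : q ≠ 0 := nonZeroDivisors.ne_zero hq
        have hq1 : algebraMap R K q ≠ 0 := by
          rwa [Ne, FaithfulSMul.algebraMap_eq_zero_iff]
        refine ⟨t * q, mul_ne_zero ht hq0, p • b, hsm m _ _ hb, ?_⟩
        have e1 : h (p • b) = p • h b := by
          funext i; simp [h]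
        rw [e1, ← hx, ← algebraMap_smul K (t * q), ← algebraMap_smul K p, ← algebraMap_smul K t x,
          smul_smul, smul_smul]
        congr 1
        rw [map_mul, mul_assoc, mul_div_cancel₀ _ hq1, mul_comm]
    obtain ⟨t, ht, b, hb, hab⟩ := key _ ha
    have e1 : h (t • a) = t • h a := by
      funext i; simp [h]
    have e2 : t • a = b := hinj _ _ (by rw [e1, hab])
    obtain ⟨k, c, hc⟩ := exists_pow_mem_span r hr t ht
    apply hrk k
    rw [hc, mul_smul, e2]
    exact hsm m _ _ hb
  refine isSemilocalRing_of_finset (t₁ ∪ t₂) ?_ ?_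
  · intro m hm
    rcases Finset.mem_union.mp hm with h | h
    · exact (ht₁ m h).1
    · exact (ht₂ m h).1
  · intro a ha m hm
    by_cases hrm : r • (1 : Module.End S M) ∈ m
    · exact hJ₁ a (fun m hm => ha m (Finset.mem_union_left _ hm)) m ⟨hm, hrm⟩
    · exact hJ₂ a (fun m hm => ha m (Finset.mem_union_right _ hm)) m ⟨hm, hrm⟩
end
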